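/- arXiv:1210.6946 — 4 statements merged into one kernel-verified Lean document; each statement's English description precedes it below -/
import Mathlib

section
/- Assume GRH. There is an absolute constant B₀ > 0 such that the following holds for every q ≥ 3. Let μ_q be a Borel probability measure on ℝ such that for every bounded Lipschitz continuous f : ℝ → ℝ, lim_{Y→∞} (1/Y)·∫₂^Y f(E_q(e^y)) dy = ∫_ℝ f dμ_q, with finite mean E = ∫ t dμ_q and variance V = ∫ t² dμ_q − E². If E/√V ≥ B₀, then δ̲(q;NR,R) ≥ 1 − 2V/E². -/
open Filter Topology MeasureTheory

noncomputable section

/-- The L-function of a Dirichlet character mod `q`, as a total function (junk value `0`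
when `q = 0`). -/
def LFun (q : ℕ) (χ : DirichletCharacter ℂ q) (s : ℂ) : ℂ :=
  if h : q ≠ 0 then
    haveI : NeZero q := ⟨h⟩
    DirichletCharacter.LFunction χ s
  else 0

/-- GRH for all Dirichlet L-functions. -/
def GRH : Prop :=
  ∀ (N : ℕ) (χ : DirichletCharacter ℂ N), N ≠ 0 → χ.IsPrimitive →
    ∀ s : ℂ, 0 < s.re → s.re < 1 → LFun N χ s = 0 → s.re = 1 / 2

/-- The set of nonnegative imaginary parts of nontrivial zeros of L-functions of primitive
Dirichlet characters mod `q`. -/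
def LISet (q : ℕ) : Set ℝ :=
  {γ : ℝ | 0 ≤ γ ∧ ∃ χ : DirichletCharacter ℂ q, χ.IsPrimitive ∧
    ∃ s : ℂ, 0 < s.re ∧ s.re < 1 ∧ s.im = γ ∧ LFun q χ s = 0}

/-- The Linear Independence hypothesis for modulus `q`. -/
def LI (q : ℕ) : Prop :=
  LinearIndependent ℚ ((↑) : LISet q → ℝ)

/-- Number of primes `p ≤ x` with `p ≡ a (mod q)`. -/
def primePi (q : ℕ) (a : ZMod q) (x : ℝ) : ℕ :=
  Nat.card {p : ℕ | p.Prime ∧ (p : ℝ) ≤ x ∧ (p : ZMod q) = a}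

/-- Number of primes `p ≤ x` whose residue class mod `q` is a square in `(ZMod q)ˣ`. -/
def primePiR (q : ℕ) (x : ℝ) : ℕ :=
  Nat.card {p : ℕ | p.Prime ∧ (p : ℝ) ≤ x ∧
    ∃ u : (ZMod q)ˣ, ((u : ZMod q)) ^ 2 = (p : ZMod q)}

/-- Number of primes `p ≤ x` coprime to `q` whose residue class mod `q` is not a square
in `(ZMod q)ˣ`. -/
def primePiNR (q : ℕ) (x : ℝ) : ℕ :=
  Nat.card {p : ℕ | p.Prime ∧ (p : ℝ) ≤ x ∧ IsUnit (p : ZMod q) ∧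
    ¬ ∃ u : (ZMod q)ˣ, ((u : ZMod q)) ^ 2 = (p : ZMod q)}

/-- `ρ(q)`: the index of the subgroup of squares in `(ZMod q)ˣ`. -/
def rho (q : ℕ) : ℕ :=
  (MonoidHom.range (powMonoidHom 2 : (ZMod q)ˣ →* (ZMod q)ˣ)).index

/-- Partial logarithmic averages of a set of naturals. -/
def logSum (P : Set ℕ) (N : ℕ) : ℝ :=
  (Real.log N)⁻¹ * ∑ n ∈ Finset.range (N + 1), Set.indicator P (fun n => (n : ℝ)⁻¹) n

/-- `P` has logarithmic density `d`. -/
def HasLogDensity (P : Set ℕ) (d : ℝ) : Prop :=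
  Filter.Tendsto (logSum P) Filter.atTop (nhds d)

/-- The set of `n` for which non-residues beat residues:
`π(n;q,NR) > (ρ(q)-1)·π(n;q,R)`. -/
def raceNR (q : ℕ) : Set ℕ :=
  {n : ℕ | ((rho q : ℝ) - 1) * primePiR q n < primePiNR q n}

open Classical in
/-- The multiplicity (analytic order) of `s` as a zero of `f`. -/
def zeroMult (f : ℂ → ℂ) (s : ℂ) : ℕ :=
  if h : ∃ n : ℕ, ∃ g : ℂ → ℂ, AnalyticAt ℂ g s ∧ g s ≠ 0 ∧
      (∀ᶠ z in nhds s, f z = (z - s) ^ n * g z)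
  then h.choose else 0

/-- The product of the L-functions of the nontrivial real (quadratic) characters mod `q`. -/
def Zfun (q : ℕ) (s : ℂ) : ℂ :=
  ∏ᶠ χ ∈ {χ : DirichletCharacter ℂ q | χ ^ 2 = 1 ∧ χ ≠ 1}, LFun q χ s

/-- `∑_γ m(γ)/(1/4+γ²)`, the sum over the zeros `1/2+iγ` of `L(s,χ)`, with multiplicity. -/
def zeroSumInv (q : ℕ) (χ : DirichletCharacter ℂ q) : ℝ :=
  ∑' γ : ℝ, (zeroMult (LFun q χ) (1 / 2 + γ * Complex.I) : ℝ) / (1 / 4 + γ ^ 2)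

/-- `ω(q)`: number of distinct prime factors. -/
def omega (q : ℕ) : ℕ := q.primeFactors.card

/-- The radical `q' = ∏_{p ∣ q} p`. -/
def radical (q : ℕ) : ℕ := ∏ p ∈ q.primeFactors, p

/-- The race set for a general linear combination of prime counting functions. -/
def raceSet (q : ℕ) {k : ℕ} (a : Fin k → (ZMod q)ˣ) (α : Fin k → ℝ) : Set ℕ :=
  {n : ℕ | 0 < ∑ i, α i * primePi q ((a i : ZMod q)) n}

/-- `E_q(x) = (π(x;q,NR) − (ρ(q)−1)π(x;q,R))·log x/√x`. -/
def Efun (q : ℕ) (x : ℝ) : ℝ :=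
  ((primePiNR q x : ℝ) - ((rho q : ℝ) - 1) * primePiR q x) * Real.log x / Real.sqrt x

/-- `μ` is the limiting logarithmic distribution of `E_q(e^y)`. -/
def IsLimitingDistribution (q : ℕ) (μ : Measure ℝ) : Prop :=
  IsProbabilityMeasure μ ∧
    ∀ f : ℝ → ℝ, (∃ C : ℝ, ∀ x, |f x| ≤ C) → (∃ K : NNReal, LipschitzWith K f) →
      Tendsto (fun Y : ℝ => (1 / Y) * ∫ y in (2:ℝ)..Y, f (Efun q (Real.exp y)))
        atTop (nhds (∫ t, f t ∂μ))

/-- `S(q)`: sum over the nontrivial real characters mod `q` of `∑_γ m(γ)/(1/4+γ²)`. -/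
def Sq (q : ℕ) : ℝ :=
  ∑ᶠ χ ∈ {χ : DirichletCharacter ℂ q | χ ^ 2 = 1 ∧ χ ≠ 1}, zeroSumInv q χ

/-- The standard normal distribution function `Φ`. -/
def normalCDF (x : ℝ) : ℝ :=
  (Real.sqrt (2 * Real.pi))⁻¹ * ∫ t in Set.Iic x, Real.exp (-t ^ 2 / 2)

end

theorem cast_le_natFloor_iff {x : ℝ} (hx : 0 ≤ x) (p : ℕ) :
    (p : ℝ) ≤ ((⌊x⌋₊ : ℕ) : ℝ) ↔ (p : ℝ) ≤ x := by
  rw [Nat.cast_le, Nat.le_floor_iff hx]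

theorem primePiR_natFloor (q : ℕ) {x : ℝ} (hx : 0 ≤ x) :
    primePiR q (⌊x⌋₊ : ℕ) = primePiR q x := by
  simp only [primePiR, cast_le_natFloor_iff hx]

theorem primePiNR_natFloor (q : ℕ) {x : ℝ} (hx : 0 ≤ x) :
    primePiNR q (⌊x⌋₊ : ℕ) = primePiNR q x := by
  simp only [primePiNR, cast_le_natFloor_iff hx]

theorem natFloor_mem_raceNR {q : ℕ} {x : ℝ} (hx : 1 < x) (h : 0 < Efun q x) :
    ⌊x⌋₊ ∈ raceNR q := by
  have hx0 : 0 < x := by linarith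
  change ((rho q : ℝ) - 1) * primePiR q (⌊x⌋₊ : ℕ) < primePiNR q (⌊x⌋₊ : ℕ)
  rw [primePiR_natFloor q hx0.le, primePiNR_natFloor q hx0.le, ← sub_pos]
  have h1 := (div_pos_iff_of_pos_right (Real.sqrt_pos.2 hx0)).1 h
  exact (mul_pos_iff_of_pos_right (Real.log_pos hx)).1 h1

/-- Over `[2, log N]`, a function of `y` bounded by `1` that is nonpositive unless `⌊e ^ y⌋₊ ∈ P`
has integral at most the harmonic sum over the elements of `P` up to `N`. -/
theorem intervalIntegral_le_sum_indicator_inv (P : Set ℕ) (g : ℝ → ℝ) (hg0 : ∀ y, 0 ≤ g y)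
    (hg1 : ∀ y, g y ≤ 1) (hg : ∀ y, 0 < y → 0 < g y → ⌊Real.exp y⌋₊ ∈ P) (N : ℕ)
    (hN : 2 ≤ Real.log N) :
    ∫ y in (2 : ℝ)..Real.log N, g y ≤
      ∑ n ∈ Finset.range (N + 1), P.indicator (fun n => (n : ℝ)⁻¹) n := by
  set H : ℕ → ℝ → ℝ := fun n =>
    (Set.Ico (Real.log n) (Real.log (n + 1))).indicator fun _ => P.indicator (fun _ => (1 : ℝ)) n
    with hH
  have hH0 : ∀ n y, 0 ≤ H n y := fun n y =>
    Set.indicator_nonneg (fun _ _ => Set.indicator_nonneg (fun _ _ => zero_le_one) _) _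
  have hHi : ∀ n, Integrable (H n) := fun n =>
    (integrable_indicator_iff measurableSet_Ico).2
      (integrableOn_const (by simp))
  have hsum : Integrable fun y => ∑ n ∈ Finset.range (N + 1), H n y :=
    integrable_finsetSum _ fun n _ => hHi n
  have hle : ∀ y ∈ Set.Ioc (2 : ℝ) (Real.log N), g y ≤ ∑ n ∈ Finset.range (N + 1), H n y := by
    intro y hy
    rcases (hg0 y).eq_or_lt with h0 | hpos
    · rw [← h0]
      exact Finset.sum_nonneg fun n _ => hH0 n y
    have hy0 : 0 < y := by linarith [hy.1]
    have hmem := hg y hy0 hpos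
    have hN0 : (0 : ℝ) < N := by
      rcases Nat.eq_zero_or_pos N with rfl | h
      · norm_num at hN
      · exact_mod_cast h
    have hn0 : 0 < ⌊Real.exp y⌋₊ := Nat.floor_pos.2 (Real.one_le_exp hy0.le)
    have hnN : ⌊Real.exp y⌋₊ ≤ N := by
      have : Real.exp y ≤ N := (Real.le_log_iff_exp_le hN0).1 hy.2
      exact_mod_cast (Nat.floor_le (Real.exp_pos y).le).trans this
    have hIco : y ∈ Set.Ico (Real.log ⌊Real.exp y⌋₊) (Real.log ((⌊Real.exp y⌋₊ : ℝ) + 1)) :=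
      ⟨(Real.log_le_iff_le_exp (by exact_mod_cast hn0)).2 (Nat.floor_le (Real.exp_pos y).le),
        (Real.lt_log_iff_exp_lt (by positivity)).2 (Nat.lt_floor_add_one _)⟩
    have hval : H ⌊Real.exp y⌋₊ y = 1 := by
      simp only [hH]
      rw [Set.indicator_of_mem hIco, Set.indicator_of_mem hmem]
    calc g y ≤ H ⌊Real.exp y⌋₊ y := by rw [hval]; exact hg1 y
      _ ≤ _ := Finset.single_le_sum (f := fun n => H n y) (fun n _ => hH0 n y)
        (Finset.mem_range.2 (Nat.lt_succ_of_le hnN))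
  rw [intervalIntegral.integral_of_le hN]
  calc ∫ y in Set.Ioc (2 : ℝ) (Real.log N), g y
      ≤ ∫ y in Set.Ioc (2 : ℝ) (Real.log N), ∑ n ∈ Finset.range (N + 1), H n y :=
        integral_mono_of_nonneg (Eventually.of_forall hg0) hsum.integrableOn
          ((ae_restrict_iff' measurableSet_Ioc).2 (Eventually.of_forall hle))
    _ ≤ ∫ y, ∑ n ∈ Finset.range (N + 1), H n y :=
        setIntegral_le_integral hsum
          (Eventually.of_forall fun y => Finset.sum_nonneg fun n _ => hH0 n y)
    _ = ∑ n ∈ Finset.range (N + 1), ∫ y, H n y := integral_finsetSum _ fun n _ => hHi n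
    _ ≤ _ := by
        refine Finset.sum_le_sum fun n _ => ?_
        rcases Nat.eq_zero_or_pos n with rfl | hn
        · simp [hH, Set.indicator]
        have hn' : (0 : ℝ) < n := by exact_mod_cast hn
        have hlog : Real.log n ≤ Real.log (n + 1) := Real.log_le_log hn' (by linarith)
        simp only [hH]
        rw [integral_indicator_const _ measurableSet_Ico, measureReal_def, Real.volume_Ico,
          ENNReal.toReal_ofReal (sub_nonneg.2 hlog), smul_eq_mul]
        by_cases hP : n ∈ P
        · rw [Set.indicator_of_mem hP, Set.indicator_of_mem hP, mul_one,
            ← Real.log_div (by positivity) hn'.ne']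
          refine (Real.log_le_sub_one_of_pos (by positivity)).trans (le_of_eq ?_)
          field_simp
          ring
        · simp [Set.indicator_of_notMem hP]

theorem sum_indicator_inv_le (P : Set ℕ) (N : ℕ) :
    ∑ n ∈ Finset.range (N + 1), P.indicator (fun n => (n : ℝ)⁻¹) n ≤ 1 + Real.log N := by
  calc ∑ n ∈ Finset.range (N + 1), P.indicator (fun n => (n : ℝ)⁻¹) n
      ≤ ∑ n ∈ Finset.range (N + 1), (n : ℝ)⁻¹ :=
        Finset.sum_le_sum fun n _ => Set.indicator_le_self' (fun _ _ => by positivity) n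
    _ = (harmonic N : ℝ) := by
        rw [Finset.sum_range_succ']
        simp [harmonic]
    _ ≤ _ := harmonic_le_one_add_log N

theorem isBoundedUnder_le_logSum (P : Set ℕ) :
    IsBoundedUnder (· ≤ ·) atTop (logSum P) := by
  have hlog : Tendsto (fun N : ℕ => Real.log N) atTop atTop :=
    Real.tendsto_log_atTop.comp tendsto_natCast_atTop_atTop
  refine isBoundedUnder_of_eventually_le (a := 2) ?_
  filter_upwards [hlog.eventually_ge_atTop 1] with N hN
  have h := sum_indicator_inv_le P N
  rw [logSum, inv_mul_le_iff₀ (by linarith)]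
  linarith

theorem le_liminf_logSum (P : Set ℕ) (g : ℝ → ℝ) (hg0 : ∀ y, 0 ≤ g y)
    (hg1 : ∀ y, g y ≤ 1) (hg : ∀ y, 0 < y → 0 < g y → ⌊Real.exp y⌋₊ ∈ P) {c : ℝ}
    (hc : Tendsto (fun Y : ℝ => (1 / Y) * ∫ y in (2 : ℝ)..Y, g y) atTop (𝓝 c)) :
    c ≤ atTop.liminf (logSum P) := by
  have hlog : Tendsto (fun N : ℕ => Real.log N) atTop atTop :=
    Real.tendsto_log_atTop.comp tendsto_natCast_atTop_atTop
  have hlim := hc.comp hlog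
  rw [← hlim.liminf_eq]
  refine liminf_le_liminf ?_ hlim.isBoundedUnder_ge
    (isBoundedUnder_le_logSum P).isCoboundedUnder_ge
  filter_upwards [hlog.eventually_ge_atTop 2] with N hN
  rw [Function.comp_apply, logSum, one_div]
  exact mul_le_mul_of_nonneg_left
    (intervalIntegral_le_sum_indicator_inv P g hg0 hg1 hg N hN) (inv_nonneg.2 (by linarith))

/-- The piecewise linear function that is `0` on `(-∞, 0]` and `1` on `[a⁻¹, ∞)`. -/
def ramp (a t : ℝ) : ℝ := max 0 (min 1 (a * t))

theorem ramp_nonneg (a t : ℝ) : 0 ≤ ramp a t := le_max_left _ _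

theorem ramp_le_one (a t : ℝ) : ramp a t ≤ 1 := max_le zero_le_one (min_le_left _ _)

theorem pos_of_ramp_pos {a t : ℝ} (ha : 0 < a) (h : 0 < ramp a t) : 0 < t := by
  rcases lt_max_iff.1 h with h | h
  · exact absurd h (lt_irrefl _)
  · exact (mul_pos_iff_of_pos_left ha).1 (lt_min_iff.1 h).2

theorem ramp_eq_one {a t : ℝ} (h : 1 ≤ a * t) : ramp a t = 1 := by
  rw [ramp, min_eq_left h, max_eq_right zero_le_one]

theorem exists_lipschitzWith_ramp (a : ℝ) : ∃ K : NNReal, LipschitzWith K (ramp a) :=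
  ⟨_, ((lipschitzWith_smul a).const_min 1).const_max 0⟩

theorem one_sub_two_mul_sq_div_sq_le_ramp {E : ℝ} (hE : 0 < E) (t : ℝ) :
    1 - 2 * (t - E) ^ 2 / E ^ 2 ≤ ramp (4 / E) t := by
  rcases le_or_gt E (4 * t) with h | h
  · rw [ramp_eq_one (by rw [div_mul_eq_mul_div, le_div_iff₀ hE]; linarith)]
    have : 0 ≤ 2 * (t - E) ^ 2 / E ^ 2 := by positivity
    linarith
  · refine le_trans ?_ (ramp_nonneg _ t)
    rw [sub_nonpos, le_div_iff₀ (by positivity)]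
    nlinarith

/-- A smoothed form of Chebyshev's inequality. -/
theorem one_sub_two_mul_variance_le_integral_ramp (μ : Measure ℝ) [IsProbabilityMeasure μ]
    (h1 : Integrable (fun t : ℝ => t) μ) (h2 : Integrable (fun t : ℝ => t ^ 2) μ) {E : ℝ}
    (hE : E = ∫ t, t ∂μ) (hE0 : 0 < E) :
    1 - 2 * ((∫ t, t ^ 2 ∂μ) - E ^ 2) / E ^ 2 ≤ ∫ t, ramp (4 / E) t ∂μ := by
  obtain ⟨K, hK⟩ := exists_lipschitzWith_ramp (4 / E)
  have hramp : Integrable (ramp (4 / E)) μ :=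
    Integrable.of_bound hK.continuous.aestronglyMeasurable 1
      (Eventually.of_forall fun t => by
        rw [Real.norm_of_nonneg (ramp_nonneg _ _)]
        exact ramp_le_one _ _)
  have hlin : Integrable (fun t : ℝ => 4 / E * t - 1) μ :=
    (h1.const_mul _).sub (integrable_const _)
  have hsq : Integrable (fun t : ℝ => 2 / E ^ 2 * t ^ 2) μ := h2.const_mul _
  calc 1 - 2 * ((∫ t, t ^ 2 ∂μ) - E ^ 2) / E ^ 2
      = ∫ t, ((4 / E * t - 1) - 2 / E ^ 2 * t ^ 2) ∂μ := by
        rw [integral_sub hlin hsq, integral_sub (h1.const_mul _) (integrable_const _),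
          integral_const_mul, integral_const_mul, ← hE]
        simp only [integral_const, probReal_univ, one_smul]
        field_simp
        ring
    _ ≤ _ := by
        refine integral_mono (hlin.sub hsq) hramp fun t => ?_
        refine le_trans (le_of_eq ?_) (one_sub_two_mul_sq_div_sq_le_ramp hE0 t)
        simp only
        field_simp
        ring

open scoped Classical
open Asymptotics

theorem chebyshev_lower_bound_for_density (hGRH : GRH) :
    ∃ B₀ : ℝ, 0 < B₀ ∧ ∀ q : ℕ, 3 ≤ q → ∀ μ : MeasureTheory.Measure ℝ,
      IsLimitingDistribution q μ →
      MeasureTheory.Integrable (fun t : ℝ => t) μ →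
      MeasureTheory.Integrable (fun t : ℝ => t ^ 2) μ →
      ∀ E V : ℝ, E = ∫ t, t ∂μ → V = (∫ t, t ^ 2 ∂μ) - E ^ 2 →
        B₀ ≤ E / Real.sqrt V →
        1 - 2 * V / E ^ 2 ≤ Filter.atTop.liminf (logSum (raceNR q)) := by
  refine ⟨1, one_pos, fun q _ μ hμ h1 h2 E V hE hV hB => ?_⟩
  have hE0 : 0 < E := by
    by_contra! h
    linarith [div_nonpos_of_nonpos_of_nonneg h (Real.sqrt_nonneg V)]
  have ha : 0 < 4 / E := by positivity
  have := hμ.1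
  have hlim := hμ.2 (ramp (4 / E))
    ⟨1, fun t => abs_le.2 ⟨by linarith [ramp_nonneg (4 / E) t], ramp_le_one _ _⟩⟩
    (exists_lipschitzWith_ramp _)
  rw [hV]
  exact (one_sub_two_mul_variance_le_integral_ramp μ h1 h2 hE hE0).trans
    (le_liminf_logSum _ _ (fun y => ramp_nonneg _ _) (fun y => ramp_le_one _ _)
      (fun y hy h => natFloor_mem_raceNR (Real.one_lt_exp_iff.2 hy) (pos_of_ramp_pos ha h)) hlim)
end

section
/- For every real number c with 0 < c < ∞, there exists a strictly increasing sequence {q_n} of odd squarefree positive integers such that 2^{ω(q_n)+1}/log q_n → c as n → ∞, where ω(q) denotes the number of distinct prime factors of q. -/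
open Filter Topology MeasureTheory

open scoped Classical
open Asymptotics

/-- An odd squarefree number all of whose prime factors are at most `N` can be multiplied by a
prime in `(N, 2 * N]`. -/
lemma exists_odd_squarefree_mul_prime {Q N : ℕ} (hodd : Odd Q) (hsq : Squarefree Q)
    (hN : 2 ≤ N) (hfac : ∀ p ∈ Q.primeFactors, p ≤ N) :
    ∃ p, p.Prime ∧ N < p ∧ p ≤ 2 * N ∧ Odd (Q * p) ∧ Squarefree (Q * p) ∧
      (Q * p).primeFactors = insert p Q.primeFactors ∧ p ∉ Q.primeFactors := by
  obtain ⟨p, hp, hlt, hle⟩ := Nat.exists_prime_lt_and_le_two_mul N (by omega)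
  have hnot : p ∉ Q.primeFactors := fun h => absurd (hfac p h) (by omega)
  have hQ : Q ≠ 0 := hsq.ne_zero
  have hndvd : ¬ p ∣ Q := fun h => hnot (Nat.mem_primeFactors.2 ⟨hp, h, hQ⟩)
  have hcop : Q.Coprime p := ((Nat.Prime.coprime_iff_not_dvd hp).2 hndvd).symm
  refine ⟨p, hp, hlt, hle, hodd.mul (hp.odd_of_ne_two (by omega)), ?_, ?_, hnot⟩
  · exact (Nat.squarefree_mul hcop).2 ⟨hsq, hp.prime.squarefree⟩
  · rw [Nat.primeFactors_mul hQ hp.ne_zero, hp.primeFactors, Finset.union_comm,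
      Finset.insert_eq]

/-- For each `n` there is an odd squarefree number with `n` prime factors, none of them large. -/
lemma exists_odd_squarefree_card_primeFactors (n : ℕ) :
    ∃ Q : ℕ, Odd Q ∧ Squarefree Q ∧ Q.primeFactors.card = n ∧
      (∀ p ∈ Q.primeFactors, p ≤ 2 ^ (n + 1)) ∧ Q ≤ 2 ^ ((n + 1) ^ 2) := by
  induction n with
  | zero => exact ⟨1, by simp⟩
  | succ n ih =>
    obtain ⟨Q, hodd, hsq, hcard, hfac, hle⟩ := ih
    obtain ⟨p, -, -, hp2, hodd', hsq', hpf, hnot⟩ :=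
      exists_odd_squarefree_mul_prime hodd hsq (Nat.le_self_pow (by omega) 2) hfac
    have hp2' : p ≤ 2 ^ (n + 1 + 1) := by rw [pow_succ]; omega
    refine ⟨Q * p, hodd', hsq', ?_, ?_, ?_⟩
    · rw [hpf, Finset.card_insert_of_notMem hnot, hcard]
    · intro r hr
      rw [hpf, Finset.mem_insert] at hr
      rcases hr with rfl | hr
      · exact hp2'
      · exact (hfac r hr).trans (Nat.pow_le_pow_right (by omega) (by omega))
    · calc Q * p ≤ 2 ^ ((n + 1) ^ 2) * 2 ^ (n + 1 + 1) := Nat.mul_le_mul hle hp2'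
        _ = 2 ^ ((n + 1) ^ 2 + (n + 1 + 1)) := (pow_add _ _ _).symm
        _ ≤ 2 ^ ((n + 1 + 1) ^ 2) := Nat.pow_le_pow_right (by omega) (by nlinarith)

/-- For `X` large compared with `n` there is an odd squarefree number with `n + 1` prime factors
in `[X / 2, 2 * X]`. -/
lemma exists_odd_squarefree_mem_Icc {n : ℕ} {X : ℝ}
    (hX : (2 : ℝ) ^ ((n + 1) ^ 2 + (n + 1)) ≤ X) :
    ∃ q : ℕ, Odd q ∧ Squarefree q ∧ q.primeFactors.card = n + 1 ∧
      X / 2 ≤ q ∧ (q : ℝ) ≤ 2 * X := by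
  obtain ⟨Q, hodd, hsq, hcard, hfac, hle⟩ := exists_odd_squarefree_card_primeFactors n
  have hQ : (0 : ℝ) < Q := by exact_mod_cast hsq.ne_zero.bot_lt
  have hQle : (Q : ℝ) ≤ 2 ^ ((n + 1) ^ 2) := by exact_mod_cast hle
  have hXQ : (2 : ℝ) ^ (n + 1) ≤ X / Q := by
    rw [le_div_iff₀ hQ]
    calc (2 : ℝ) ^ (n + 1) * Q ≤ 2 ^ (n + 1) * 2 ^ ((n + 1) ^ 2) := by gcongr
      _ = 2 ^ ((n + 1) ^ 2 + (n + 1)) := by rw [pow_add _ ((n + 1) ^ 2), mul_comm]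
      _ ≤ X := hX
  have hX0 : 0 ≤ X / Q := le_trans (by positivity) hXQ
  set N := ⌊X / Q⌋₊ with hNdef
  have hN : 2 ^ (n + 1) ≤ N := Nat.le_floor (by exact_mod_cast hXQ)
  have hN2 : 2 ≤ N := (Nat.le_self_pow (by omega) 2).trans hN
  obtain ⟨p, -, hp1, hp2, hodd', hsq', hpf, hnot⟩ :=
    exists_odd_squarefree_mul_prime hodd hsq hN2 fun r hr => (hfac r hr).trans hN
  have hlow : X / Q < N + 1 := Nat.lt_floor_add_one _
  have hhigh : (N : ℝ) ≤ X / Q := Nat.floor_le hX0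
  rw [div_lt_iff₀ hQ] at hlow
  rw [le_div_iff₀ hQ] at hhigh
  have hp1' : (N : ℝ) + 1 ≤ p := by exact_mod_cast hp1
  have hp2' : (p : ℝ) ≤ 2 * N := by exact_mod_cast hp2
  have hXpos : 0 < X := lt_of_lt_of_le (by positivity) hX
  refine ⟨Q * p, hodd', hsq', ?_, ?_, ?_⟩
  · rw [hpf, Finset.card_insert_of_notMem hnot, hcard]
  · push_cast
    nlinarith
  · push_cast
    nlinarith

/-- For every real `b > 0`, polynomial exponents are eventually dominated by `b * 2 ^ n`. -/
lemma eventually_two_pow_le_exp {b : ℝ} (hb : 0 < b) :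
    ∀ᶠ n : ℕ in atTop, (2 : ℝ) ^ ((n + 1) ^ 2 + (n + 1)) ≤ Real.exp (b * 2 ^ (n + 2)) := by
  have h := (tendsto_pow_const_div_const_pow_of_one_lt 2 (one_lt_two : (1 : ℝ) < 2)).eventually
    (gt_mem_nhds (show (0 : ℝ) < b / 2 by positivity))
  filter_upwards [(tendsto_add_atTop_nat 2).eventually h] with n hn
  rw [div_lt_iff₀ (by positivity)] at hn
  push_cast at hn
  have hlog : Real.log 2 ≤ 1 := by linarith [Real.log_two_lt_d9]
  rw [← Real.log_le_iff_le_exp (by positivity), Real.log_pow]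
  have hn0 : (0 : ℝ) ≤ n := n.cast_nonneg
  push_cast
  calc (((n : ℝ) + 1) ^ 2 + (n + 1)) * Real.log 2 ≤ (((n : ℝ) + 1) ^ 2 + (n + 1)) * 1 := by gcongr
    _ ≤ ((n : ℝ) + 2) ^ 2 := by nlinarith
    _ ≤ b * 2 ^ (n + 2) := by nlinarith [show (0 : ℝ) < b * 2 ^ (n + 2) by positivity]

theorem moduli_with_prescribed_ratio (c : ℝ) (hc : 0 < c) :
    ∃ q : ℕ → ℕ, StrictMono q ∧ (∀ n, Odd (q n) ∧ Squarefree (q n)) ∧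
      Filter.Tendsto
        (fun n => (2 : ℝ) ^ ((q n).primeFactors.card + 1) / Real.log (q n))
        Filter.atTop (nhds c) := by
  have hev : ∀ᶠ n : ℕ in atTop, ∃ q : ℕ, (Odd q ∧ Squarefree q) ∧
      q.primeFactors.card = n + 1 ∧ |Real.log q - c⁻¹ * 2 ^ (n + 2)| ≤ Real.log 2 := by
    filter_upwards [eventually_two_pow_le_exp (inv_pos.2 hc)] with n hn
    obtain ⟨q, hodd, hsq, hcard, hlow, hhigh⟩ := exists_odd_squarefree_mem_Icc hn
    have hq : (0 : ℝ) < q := by exact_mod_cast hsq.ne_zero.bot_lt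
    have h1 := Real.log_le_log (by positivity) hlow
    have h2 := Real.log_le_log hq hhigh
    rw [Real.log_div (Real.exp_ne_zero _) two_ne_zero, Real.log_exp] at h1
    rw [Real.log_mul two_ne_zero (Real.exp_ne_zero _), Real.log_exp] at h2
    exact ⟨q, ⟨hodd, hsq⟩, hcard, abs_le.2 ⟨by linarith, by linarith⟩⟩
  obtain ⟨n₀, hn₀⟩ := eventually_atTop.1 hev
  choose q hq hcard hlog using fun n => hn₀ (n + n₀) (Nat.le_add_left _ _)
  have hpow : Tendsto (fun n : ℕ => (2 : ℝ) ^ (n + n₀ + 2)) atTop atTop :=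
    (tendsto_pow_atTop_atTop_of_one_lt one_lt_two).comp
      ((tendsto_add_atTop_nat 2).comp (tendsto_add_atTop_nat n₀))
  have hratio : Tendsto (fun n => Real.log (q n) / 2 ^ (n + n₀ + 2)) atTop (𝓝 c⁻¹) := by
    rw [tendsto_iff_norm_sub_tendsto_zero]
    refine squeeze_zero (fun _ => norm_nonneg _) (fun n => ?_)
      ((tendsto_const_nhds (x := Real.log 2)).div_atTop hpow)
    have h : Real.log (q n) / 2 ^ (n + n₀ + 2) - c⁻¹ =
        (Real.log (q n) - c⁻¹ * 2 ^ (n + n₀ + 2)) / 2 ^ (n + n₀ + 2) := by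
      field_simp
    rw [h, Real.norm_eq_abs, abs_div, abs_of_pos (show (0 : ℝ) < 2 ^ (n + n₀ + 2) by positivity)]
    gcongr
    exact hlog n
  have hlim : Tendsto (fun n => (2 : ℝ) ^ ((q n).primeFactors.card + 1) / Real.log (q n))
      atTop (𝓝 c) := by
    simpa [hcard] using hratio.inv₀ (inv_ne_zero hc.ne')
  have hlogtop : Tendsto (fun n => Real.log (q n)) atTop atTop := by
    refine (hratio.pos_mul_atTop (inv_pos.2 hc) hpow).congr fun n => ?_
    field_simp
  have htop : Tendsto q atTop atTop := by
    refine tendsto_natCast_atTop_iff.1 (tendsto_atTop_mono (fun n => ?_) hlogtop)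
    exact Real.log_le_self (Nat.cast_nonneg _)
  obtain ⟨φ, hφ, hqφ⟩ := strictMono_subseq_of_tendsto_atTop htop
  exact ⟨q ∘ φ, hqφ, fun n => hq (φ n), hlim.comp hφ.tendsto_atTop⟩
end

section
/- There is an absolute constant C > 0 such that the following holds. Let χ be a primitive Dirichlet character of conductor q* ≥ 3 for which GRH holds, i.e. every zero s of L(s,χ) with 0 < Re(s) < 1 is of the form s = 1/2 + iγ with γ ∈ ℝ. Then for every T ≥ 1, |Σ_{|γ_χ| < T} 1/√(1/4 + γ_χ²) − (1/π)·log(q*·√T)·log T| ≤ C·log(q*·T), where the sum runs over all γ with |γ| < T such that 1/2 + iγ is a zero of L(s,χ), counted with multiplicity (analytic order). -/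
open Filter Topology MeasureTheory

open scoped Classical
open Asymptotics

theorem zeroMult_eq_analyticOrderNatAt {f : ℂ → ℂ} {s : ℂ} (hf : AnalyticAt ℂ f s) :
    zeroMult f s = analyticOrderNatAt f s := by
  unfold zeroMult
  split_ifs with h
  · have := h.choose_spec
    have h' : analyticOrderAt f s = (h.choose : ℕ∞) := hf.analyticOrderAt_eq_natCast.2 (by simpa using this)
    simp [analyticOrderNatAt, h']
  · by_cases ht : analyticOrderAt f s = ⊤
    · simp [analyticOrderNatAt, ht]
    · exact absurd ⟨analyticOrderNatAt f s, by
        simpa using (hf.analyticOrderNatAt_eq_iff ht).1 rfl⟩ h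

theorem zeroMult_mul_left {f g : ℂ → ℂ} {s : ℂ} (hf : AnalyticAt ℂ f s) (hg : AnalyticAt ℂ g s)
    (hfs : f s ≠ 0) : zeroMult (f * g) s = zeroMult g s := by
  rw [zeroMult_eq_analyticOrderNatAt (hf.mul hg), zeroMult_eq_analyticOrderNatAt hg,
    analyticOrderNatAt, analyticOrderNatAt, analyticOrderAt_mul hf hg,
    hf.analyticOrderAt_eq_zero.2 hfs, zero_add]

theorem zeroMult_comp_add_left {f : ℂ → ℂ} (a s : ℂ) :
    zeroMult (fun z => f (a + z)) s = zeroMult f (a + s) := by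
  have key : ∀ n : ℕ, (∃ g : ℂ → ℂ, AnalyticAt ℂ g s ∧ g s ≠ 0 ∧
      ∀ᶠ z in 𝓝 s, f (a + z) = (z - s) ^ n * g z) ↔ ∃ g : ℂ → ℂ, AnalyticAt ℂ g (a + s) ∧
      g (a + s) ≠ 0 ∧ ∀ᶠ z in 𝓝 (a + s), f z = (z - (a + s)) ^ n * g z := by
    intro n
    constructor
    · rintro ⟨g, hg, hgs, h⟩
      refine ⟨fun z => g (z - a), ?_, by simpa using hgs, ?_⟩
      · exact AnalyticAt.fun_comp (by simpa using hg) (by fun_prop)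
      · have : Tendsto (fun z => z - a) (𝓝 (a + s)) (𝓝 s) := by
          have : ContinuousAt (fun z => z - a) (a + s) := by fun_prop
          simpa [ContinuousAt] using this
        filter_upwards [this.eventually h] with z hz
        rw [← sub_sub, ← hz, add_sub_cancel]
    · rintro ⟨g, hg, hgs, h⟩
      refine ⟨fun z => g (a + z), AnalyticAt.fun_comp hg (by fun_prop), hgs, ?_⟩
      have : Tendsto (fun z => a + z) (𝓝 s) (𝓝 (a + s)) :=
        Continuous.tendsto (by fun_prop) _
      filter_upwards [this.eventually h] with z hz
      rw [hz, add_sub_add_left_eq_sub]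
  simp only [zeroMult, key]

theorem Differentiable.exists_eq_pow_mul {f : ℂ → ℂ} (hf : Differentiable ℂ f) {s : ℂ}
    (hs : analyticOrderAt f s ≠ ⊤) :
    ∃ g : ℂ → ℂ, Differentiable ℂ g ∧ g s ≠ 0 ∧ ∀ z, f z = (z - s) ^ analyticOrderNatAt f s * g z := by
  obtain ⟨g, hg, hgs, h⟩ := ((hf.analyticAt s).analyticOrderNatAt_eq_iff hs).1 rfl
  set n := analyticOrderNatAt f s
  have key : Function.update (fun z => f z / (z - s) ^ n) s (g s) =ᶠ[𝓝 s] g := by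
    filter_upwards [h] with z hz
    rcases eq_or_ne z s with rfl | hzs
    · simp
    · have : z - s ≠ 0 := sub_ne_zero.2 hzs
      simp [hzs, hz, this]
  refine ⟨Function.update (fun z => f z / (z - s) ^ n) s (g s), fun z => ?_, by simpa, fun z => ?_⟩
  · rcases eq_or_ne z s with rfl | hzs
    · exact key.differentiableAt_iff.2 hg.differentiableAt
    · have : (Function.update (fun z => f z / (z - s) ^ n) s (g s)) =ᶠ[𝓝 z]
          (fun z => f z / (z - s) ^ n) := by
        filter_upwards [isOpen_ne.mem_nhds hzs] with w hw
        simp [Function.update_of_ne hw]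
      refine this.differentiableAt_iff.2 ((hf z).div (by fun_prop) ?_)
      exact pow_ne_zero _ (sub_ne_zero.2 hzs)
  · rcases eq_or_ne z s with rfl | hzs
    · have := h.self_of_nhds
      simpa using this
    · have : z - s ≠ 0 := sub_ne_zero.2 hzs
      simp [hzs]
      field_simp

theorem Differentiable.exists_eq_prod_pow_mul {f : ℂ → ℂ} (hf : Differentiable ℂ f)
    (ht : ∀ s, analyticOrderAt f s ≠ ⊤) (S : Finset ℂ) :
    ∃ g : ℂ → ℂ, Differentiable ℂ g ∧ (∀ s ∈ S, g s ≠ 0) ∧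
      ∀ z, f z = (∏ s ∈ S, (z - s) ^ zeroMult f s) * g z := by
  induction S using Finset.induction_on with
  | empty => exact ⟨f, hf, by simp, by simp⟩
  | insert a S ha ih =>
    obtain ⟨g, hg, hgS, hfg⟩ := ih
    have hP : Differentiable ℂ fun z => ∏ s ∈ S, (z - s) ^ zeroMult f s := by fun_prop
    have hPa : (∏ s ∈ S, (a - s) ^ zeroMult f s) ≠ 0 :=
      Finset.prod_ne_zero_iff.2 fun s hs => pow_ne_zero _ <| sub_ne_zero.2 <| by
        rintro rfl; exact ha hs
    have hord : analyticOrderAt f a = analyticOrderAt g a := by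
      have : f = (fun z => ∏ s ∈ S, (z - s) ^ zeroMult f s) * g := funext hfg
      rw [this, analyticOrderAt_mul (hP.analyticAt a) (hg.analyticAt a),
        (hP.analyticAt a).analyticOrderAt_eq_zero.2 hPa, zero_add]
    obtain ⟨h, hh, hha, hgh⟩ := hg.exists_eq_pow_mul (s := a) (hord ▸ ht a)
    refine ⟨h, hh, ?_, fun z => ?_⟩
    · intro s hs
      rcases Finset.mem_insert.1 hs with rfl | hs
      · exact hha
      · intro h0
        exact hgS s hs (by rw [hgh, h0, mul_zero])
    · rw [Finset.prod_insert ha, zeroMult_eq_analyticOrderNatAt (hf.analyticAt a),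
        analyticOrderNatAt, hord, ← analyticOrderNatAt, hfg z, hgh z]
      ring

theorem norm_logDeriv_sub_le_of_norm_le_exp {g : ℂ → ℂ} (hg : Differentiable ℂ g) {c : ℂ} {r M : ℝ}
    (hM : 0 < M) (hr : 0 < r) (hg0 : ∀ z ∈ Metric.ball c r, g z ≠ 0)
    (hgM : ∀ z ∈ Metric.ball c r, ‖g z‖ ≤ Real.exp M * ‖g c‖) {a b : ℂ}
    (ha : a ∈ Metric.ball c (r / 8)) (hb : b ∈ Metric.ball c (r / 8)) :
    ‖logDeriv g a - logDeriv g b‖ ≤ 64 * M / r ^ 2 * ‖a - b‖ := by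
  have hcr : c ∈ Metric.ball c r := Metric.mem_ball_self hr
  have hgc : g c ≠ 0 := hg0 c hcr
  have hg' : Differentiable ℂ (deriv g) := fun z => (hg.analyticAt z).deriv.differentiableAt
  have hld : DifferentiableOn ℂ (logDeriv g) (Metric.ball c r) := fun z hz =>
    ((hg' z).div (hg z) (hg0 z hz)).differentiableWithinAt
  obtain ⟨h, hhc, hh⟩ := (hld.isExactOn_ball).with_val_at c 0
  have hexp : ∀ z ∈ Metric.ball c r, g z = g c * Complex.exp (h z) := by
    have hd : ∀ z ∈ Metric.ball c r, HasDerivAt (fun z => g z * Complex.exp (-h z)) 0 z := by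
      intro z hz
      have h1 := (hg z).hasDerivAt.mul ((hh z hz).neg.cexp)
      have h2 : deriv g z * Complex.exp ((-h) z) +
          g z * (Complex.exp ((-h) z) * -logDeriv g z) = 0 := by
        rw [logDeriv_apply]
        field_simp [hg0 z hz]
        ring
      rwa [h2] at h1
    intro z hz
    have hconst := (convex_ball c r).is_const_of_fderivWithin_eq_zero (𝕜 := ℂ)
      (f := fun z => g z * Complex.exp (-h z))
      (fun w hw => (hd w hw).differentiableAt.differentiableWithinAt) (by
        intro w hw
        rw [fderivWithin_of_isOpen Metric.isOpen_ball hw]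
        ext
        simpa using (hd w hw).deriv) hz hcr
    simp only [hhc, neg_zero, Complex.exp_zero, mul_one] at hconst
    rw [← hconst, mul_assoc, ← Complex.exp_add]
    simp
  have hre : ∀ z ∈ Metric.ball c r, (h z).re ≤ M := by
    intro z hz
    have h1 := hgM z hz
    rw [hexp z hz, norm_mul, Complex.norm_exp, mul_comm] at h1
    exact Real.exp_le_exp.1 (le_of_mul_le_mul_right h1 (norm_pos_iff.2 hgc))
  have hBC : ∀ z ∈ Metric.ball c (r / 2), ‖h z‖ ≤ 2 * M := by
    intro z hz
    have hz' : ‖z - c‖ < r / 2 := by simpa [dist_eq_norm] using hz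
    have h1 := Complex.borelCaratheodory_zero (f := fun w => h (w + c)) (z := z - c) hM
      (R := r) (by
        intro w hw
        have hw' : w + c ∈ Metric.ball c r := by simpa [dist_eq_norm] using hw
        have := (hh (w + c) hw').differentiableAt
        exact (this.comp w (by fun_prop : DifferentiableAt ℂ (fun w => w + c) w)).differentiableWithinAt)
      (by
        intro w hw
        exact hre (w + c) (by simpa [dist_eq_norm] using hw)) hr
      (by simp; linarith) (by simpa using hhc)
    simp only [sub_add_cancel] at h1
    refine h1.trans ?_
    rw [div_le_iff₀ (by linarith)]
    nlinarith
  have hdh : ∀ z ∈ Metric.ball c r, deriv h z = logDeriv g z := fun z hz => (hh z hz).deriv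
  have hsub : ∀ {s t : ℝ}, s ≤ t → Metric.ball c s ⊆ Metric.ball c t := Metric.ball_subset_ball
  have hdiff : DifferentiableOn ℂ h (Metric.ball c r) := fun z hz =>
    (hh z hz).differentiableAt.differentiableWithinAt
  have h1 : ∀ z ∈ Metric.ball c (r / 4), ‖logDeriv g z‖ ≤ 8 * M / r := by
    intro z hz
    have hz' : dist z c < r / 4 := hz
    rw [← hdh z (hsub (by linarith) hz)]
    have hcl : Metric.closedBall z (r / 4) ⊆ Metric.ball c (r / 2) := by
      intro w hw
      have := dist_triangle w z c
      have hw' : dist w z ≤ r / 4 := hw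
      simp only [Metric.mem_ball]; linarith
    have := Complex.norm_deriv_le_of_forall_mem_sphere_norm_le (c := z) (R := r / 4) (f := h)
      (C := 2 * M) (by linarith)
      (DifferentiableOn.diffContOnCl_ball (hdiff.mono (hsub (by linarith : r / 2 ≤ r))) hcl)
      (fun w hw => hBC w (hcl (Metric.sphere_subset_closedBall hw)))
    refine this.trans_eq ?_
    field_simp; norm_num
  have h2 : ∀ z ∈ Metric.ball c (r / 8), ‖deriv (logDeriv g) z‖ ≤ 64 * M / r ^ 2 := by
    intro z hz
    have hz' : dist z c < r / 8 := hz
    have hcl : Metric.closedBall z (r / 8) ⊆ Metric.ball c (r / 4) := by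
      intro w hw
      have := dist_triangle w z c
      have hw' : dist w z ≤ r / 8 := hw
      simp only [Metric.mem_ball]; linarith
    have := Complex.norm_deriv_le_of_forall_mem_sphere_norm_le (c := z) (R := r / 8)
      (f := logDeriv g) (C := 8 * M / r) (by linarith)
      (DifferentiableOn.diffContOnCl_ball (hld.mono (hsub (by linarith : r / 4 ≤ r))) hcl)
      (fun w hw => h1 w (hcl (Metric.sphere_subset_closedBall hw)))
    refine this.trans_eq ?_
    field_simp; norm_num
  exact (convex_ball c (r / 8)).norm_image_sub_le_of_norm_deriv_le
    (fun z hz => hld.differentiableAt (Metric.isOpen_ball.mem_nhds (hsub (by linarith) hz))) h2 hb ha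

theorem Differentiable.finite_zeros_closedBall {f : ℂ → ℂ} (hf : Differentiable ℂ f)
    (ht : ∀ s, analyticOrderAt f s ≠ ⊤) (R : ℝ) :
    {z | z ∈ Metric.closedBall (0 : ℂ) R ∧ f z = 0}.Finite := by
  by_contra hinf
  obtain ⟨x, -, hx⟩ := Set.Infinite.exists_accPt_of_subset_isCompact hinf
    (isCompact_closedBall (0 : ℂ) R) (fun z hz => hz.1)
  have hfr : ∃ᶠ z in 𝓝[≠] x, f z = 0 :=
    (accPt_iff_frequently_nhdsNE.1 hx).mono fun z hz => hz.2
  exact ht x (analyticOrderAt_eq_top.2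
    ((hf.analyticAt x).frequently_zero_iff_eventually_zero.1 hfr))

/-- If all zeros of an entire function of finite order at most `3 / 2` lie on the imaginary axis, then
finitely many of them determine the real part of its logarithmic derivative on `(0, Y]` up to an error
of at most `1`. -/
theorem exists_finset_zeros_sum_near_logDeriv {f : ℂ → ℂ} (hf : Differentiable ℂ f) {K : ℝ} (hK : 0 < K)
    (hgrowth : ∀ z, ‖f z‖ ≤ Real.exp (K * (1 + ‖z‖) ^ (3 / 2 : ℝ)))
    (hzero : ∀ z, f z = 0 → z.re = 0)
    (hsymm : ∀ y : ℝ, 0 < y → (logDeriv f (-y)).re = -(logDeriv f y).re) {Y : ℝ} (hY : 0 < Y) :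
    ∃ Z : Finset ℝ, (∀ γ : ℝ, |γ| < Y → f (γ * Complex.I) = 0 → γ ∈ Z) ∧
      ∀ y : ℝ, 0 < y → y ≤ Y →
        |∑ γ ∈ Z, (zeroMult f (γ * Complex.I) : ℝ) * (y / (y ^ 2 + γ ^ 2)) - (logDeriv f y).re| ≤ 1 := by
  have hf1 : f 1 ≠ 0 := fun h => by simpa using hzero 1 h
  have hf1' : 0 < ‖f 1‖ := norm_pos_iff.2 hf1
  have ht : ∀ s, analyticOrderAt f s ≠ ⊤ := by
    intro s hs
    have h0 := (AnalyticOnNhd.eqOn_zero_of_preconnected_of_eventuallyEq_zero (f := f) (U := Set.univ)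
      (fun z _ => hf.analyticAt z) isPreconnected_univ (Set.mem_univ s)
      (analyticOrderAt_eq_top.1 hs))
    exact hf1 (h0 (Set.mem_univ 1))
  set c : ℝ := |Real.log ‖f 1‖| + 1 with hc
  have hc0 : 0 < c := by positivity
  have hc1 : -Real.log ‖f 1‖ ≤ c := by linarith [neg_abs_le (Real.log ‖f 1‖)]
  clear_value c
  obtain ⟨w, hw10, hwY, hwA⟩ : ∃ w : ℝ, 100 ≤ w ∧ 100 * (Y + 1) ≤ w ∧ 64 * 36 * Y * (K + c) ≤ w :=
    ⟨max 100 (max (100 * (Y + 1)) (64 * 36 * Y * (K + c))), by simp, by simp, by simp⟩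
  have hww : 100 * w ≤ w ^ 2 := by nlinarith
  set R : ℝ := w ^ 2 - 1 with hR
  set M : ℝ := K * w ^ 3 + c with hM
  clear_value M
  have hfin := hf.finite_zeros_closedBall ht (R / 3)
  set S : Finset ℂ := hfin.toFinset with hS
  have hmem : ∀ z, z ∈ S ↔ ‖z‖ ≤ R / 3 ∧ f z = 0 := by intro z; simp [hS]
  obtain ⟨g, hg, hgS, hfg⟩ := hf.exists_eq_prod_pow_mul ht S
  set D : ℂ → ℂ := fun z => ∏ s ∈ S, (z - s) ^ zeroMult f s with hD
  have hfg' : ∀ z, f z = D z * g z := hfg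
  have hD1 : 0 < ‖D 1‖ := by
    rw [norm_pos_iff]; intro h; exact hf1 (by rw [hfg' 1, h, zero_mul])
  have hDR : ∀ z, ‖z‖ = R → ‖D 1‖ ≤ ‖D z‖ := by
    intro z hz
    simp only [hD, norm_prod, norm_pow]
    refine Finset.prod_le_prod (fun _ _ => by positivity) fun s hs => ?_
    have hs' := ((hmem s).1 hs).1
    have h1 : ‖1 - s‖ ≤ 1 + ‖s‖ := by simpa using norm_sub_le 1 s
    have h2 : ‖z‖ - ‖s‖ ≤ ‖z - s‖ := norm_sub_norm_le z s
    exact pow_le_pow_left₀ (norm_nonneg _) (by nlinarith) _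
  have hR0 : 0 < R := by nlinarith
  have hpow : (1 + R) ^ (3 / 2 : ℝ) = w ^ 3 := by
    have : (1 + R) = w ^ (2 : ℝ) := by rw [hR]; norm_num
    rw [this, ← Real.rpow_mul (by linarith)]
    norm_num
  have hgR : ∀ z ∈ Metric.closedBall (0 : ℂ) R, ‖g z‖ ≤ Real.exp M * ‖g 1‖ := by
    intro z hz
    refine Complex.norm_le_of_forall_mem_frontier_norm_le (U := Metric.ball 0 R) Metric.isBounded_ball
      hg.diffContOnCl ?_ (by rwa [closure_ball _ hR0.ne'])
    intro z hz
    rw [frontier_ball _ hR0.ne'] at hz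
    have hz' : ‖z‖ = R := by simpa using hz
    have h1 := hgrowth z
    rw [hz', hpow, hfg' z, norm_mul] at h1
    have h2 : ‖D 1‖ * ‖g z‖ ≤ Real.exp (K * w ^ 3) :=
      (mul_le_mul_of_nonneg_right (hDR z hz') (norm_nonneg _)).trans h1
    have h3 : 1 ≤ Real.exp c * ‖f 1‖ := by
      rw [← Real.exp_log hf1', ← Real.exp_add]
      apply Real.one_le_exp
      linarith
    have h4 : ‖f 1‖ = ‖D 1‖ * ‖g 1‖ := by rw [hfg' 1, norm_mul]
    refine le_of_mul_le_mul_left (h2.trans ?_) hD1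
    calc Real.exp (K * w ^ 3) = Real.exp (K * w ^ 3) * 1 := by ring
      _ ≤ Real.exp (K * w ^ 3) * (Real.exp c * ‖f 1‖) := by gcongr
      _ = ‖D 1‖ * (Real.exp M * ‖g 1‖) := by rw [hM, Real.exp_add, h4]; ring
  set r : ℝ := R / 3 - 1 with hr
  have hr0 : 0 < r := by nlinarith
  have hrw : w ^ 2 / 6 ≤ r := by nlinarith
  have hball : ∀ z ∈ Metric.ball (1 : ℂ) r, ‖z‖ ≤ R / 3 := by
    intro z hz
    have h1 : ‖z - 1‖ < r := by simpa [dist_eq_norm] using hz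
    have h2 : ‖z‖ ≤ ‖z - 1‖ + 1 := by simpa using norm_add_le (z - 1) 1
    linarith
  have hg0 : ∀ z ∈ Metric.ball (1 : ℂ) r, g z ≠ 0 := by
    intro z hz h0
    exact hgS z ((hmem z).2 ⟨hball z hz, by rw [hfg' z, h0, mul_zero]⟩) h0
  have hmain : ∀ a b : ℂ, ‖a‖ ≤ Y → ‖b‖ ≤ Y → ‖logDeriv g a - logDeriv g b‖ ≤ 2 := by
    have hin : ∀ a : ℂ, ‖a‖ ≤ Y → a ∈ Metric.ball (1 : ℂ) (r / 8) := by
      intro a ha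
      have h2 : ‖a - 1‖ ≤ ‖a‖ + 1 := by simpa using norm_sub_le a 1
      simp only [Metric.mem_ball, dist_eq_norm]
      nlinarith
    intro a b ha hb
    have hM0 : 0 < M := by rw [hM]; positivity
    refine (norm_logDeriv_sub_le_of_norm_le_exp hg hM0 hr0 hg0 (fun z hz => hgR z ?_)
      (hin a ha) (hin b hb)).trans ?_
    · have := hball z hz
      simp only [Metric.mem_closedBall, dist_zero_right]; linarith
    · have h1 : ‖a - b‖ ≤ 2 * Y := (norm_sub_le a b).trans (by linarith)
      have h2 : M ≤ (K + c) * w ^ 3 := by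
        have : 1 ≤ w ^ 3 := one_le_pow₀ (by linarith)
        nlinarith
      have h3 : (w ^ 2 / 6) ^ 2 ≤ r ^ 2 := pow_le_pow_left₀ (by positivity) hrw 2
      rw [div_mul_eq_mul_div, div_le_iff₀ (by positivity)]
      calc 64 * M * ‖a - b‖ ≤ 64 * ((K + c) * w ^ 3) * (2 * Y) := by gcongr
        _ = 64 * 36 * Y * (K + c) * (w ^ 3 / 18) := by ring
        _ ≤ w * (w ^ 3 / 18) := by gcongr
        _ = 2 * (w ^ 2 / 6) ^ 2 := by ring
        _ ≤ 2 * r ^ 2 := by gcongr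
  have him : ∀ s ∈ S, s.re = 0 := fun s hs => hzero s ((hmem s).1 hs).2
  have hinj : Set.InjOn Complex.im (S : Set ℂ) := fun s hs t ht h =>
    Complex.ext ((him s hs).trans (him t ht).symm) h
  have hld : ∀ y : ℝ, y ≠ 0 → |y| ≤ Y → (logDeriv f y).re =
      ∑ s ∈ S, (zeroMult f s : ℝ) * (y / (y ^ 2 + s.im ^ 2)) + (logDeriv g y).re := by
    intro y hy hyY
    have hys : ∀ s ∈ S, (y : ℂ) - s ≠ 0 := by
      intro s hs h
      apply hy
      have := congrArg Complex.re h
      simpa [him s hs] using this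
    have hDy : D y ≠ 0 := Finset.prod_ne_zero_iff.2 fun s hs => pow_ne_zero _ (hys s hs)
    have hgy : g y ≠ 0 := by
      intro h
      have : f y = 0 := by rw [hfg', h, mul_zero]
      exact hy (by simpa using hzero y this)
    have hDd : Differentiable ℂ D := by simp only [hD]; fun_prop
    have hfe : f = fun z => D z * g z := funext hfg'
    rw [hfe, logDeriv_mul (y : ℂ) hDy hgy (hDd y) (hg y), ← hfe, Complex.add_re]
    congr 1
    have : logDeriv D y = ∑ s ∈ S, (zeroMult f s : ℂ) * (1 / (y - s)) := by
      simp only [hD]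
      rw [logDeriv_prod (f := fun s z => (z - s) ^ zeroMult f s)]
      · refine Finset.sum_congr rfl fun s hs => ?_
        rw [logDeriv_fun_pow (by fun_prop), logDeriv_apply]
        simp
      · intro s hs; exact pow_ne_zero _ (hys s hs)
      · intro s hs; fun_prop
    rw [this, Complex.re_sum]
    refine Finset.sum_congr rfl fun s hs => ?_
    rw [← Complex.ofReal_natCast, Complex.re_ofReal_mul, one_div, Complex.inv_re, Complex.normSq_apply]
    simp [him s hs]
    left; ring
  refine ⟨S.image Complex.im, ?_, ?_⟩
  · intro γ hγ h0
    refine Finset.mem_image.2 ⟨γ * Complex.I, (hmem _).2 ⟨?_, h0⟩, by simp⟩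
    simp
    nlinarith
  · intro y hy0 hyY
    have h1 := hld y hy0.ne' (by rwa [abs_of_pos hy0])
    have h2 := hld (-y) (by linarith) (by rwa [abs_neg, abs_of_pos hy0])
    have h3 := hsymm y hy0
    push_cast at h2
    rw [h3] at h2
    have h4 := hmain y (-y) (by simpa [abs_of_pos hy0] using hyY) (by simpa [abs_of_pos hy0] using hyY)
    have h5 := (Complex.abs_re_le_norm _).trans h4
    rw [Complex.sub_re] at h5
    rw [Finset.sum_image hinj]
    have h6 : ∀ s ∈ S, (zeroMult f (s.im * Complex.I) : ℝ) = zeroMult f s := by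
      intro s hs
      congr 2
      apply Complex.ext <;> simp [him s hs]
    rw [Finset.sum_congr rfl fun s hs => by rw [h6 s hs]]
    have h7 : ∑ s ∈ S, (zeroMult f s : ℝ) * (-y / ((-y) ^ 2 + s.im ^ 2)) =
        -∑ s ∈ S, (zeroMult f s : ℝ) * (y / (y ^ 2 + s.im ^ 2)) := by
      rw [← Finset.sum_neg_distrib]
      refine Finset.sum_congr rfl fun s _ => ?_
      rw [neg_sq]; ring
    rw [h7] at h2
    rw [abs_le] at h5 ⊢
    constructor <;> linarith

theorem Real.arctan_le_of_nonneg {x : ℝ} (hx : 0 ≤ x) : Real.arctan x ≤ x := by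
  simpa using Real.le_tan (Real.arctan_nonneg.2 hx) (Real.arctan_lt_pi_div_two x)

theorem abs_indicator_sub_integral_inv_sq_add_sq_le {T γ : ℝ} (hT : 1 ≤ T) :
    |(if |γ| < T then 1 / Real.sqrt (1 / 4 + γ ^ 2) else 0) -
      2 / Real.pi * ∫ y in (3 / 2 : ℝ)..(2 * T), (y ^ 2 + γ ^ 2)⁻¹| ≤
      10 * ((3 / 2) / ((3 / 2) ^ 2 + γ ^ 2) + 2 * T / ((2 * T) ^ 2 + γ ^ 2)) := by
  have hab : (3 / 2 : ℝ) ≤ 2 * T := by linarith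
  have hpi := Real.pi_gt_three
  have hpi2 : 2 / Real.pi ≤ 2 / 3 := by gcongr
  have hpi0 : 0 ≤ 2 / Real.pi := by positivity
  have hcont : ∀ (δ : ℝ), ContinuousOn (fun y : ℝ => (y ^ 2 + δ ^ 2)⁻¹) (Set.uIcc (3 / 2) (2 * T)) := by
    intro δ
    refine ContinuousOn.inv₀ (by fun_prop) fun y hy => ?_
    rw [Set.uIcc_of_le hab] at hy
    have : 0 < y := by linarith [hy.1]
    positivity
  set k := ∫ y in (3 / 2 : ℝ)..(2 * T), (y ^ 2 + γ ^ 2)⁻¹ with hk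
  have hk0 : 0 ≤ k := intervalIntegral.integral_nonneg hab fun y _ => by positivity
  have hA : 0 ≤ 3 / 2 / ((3 / 2) ^ 2 + γ ^ 2) := by positivity
  have hB : 0 ≤ 2 * T / ((2 * T) ^ 2 + γ ^ 2) := by positivity
  have hg2 : γ ^ 2 = |γ| ^ 2 := (sq_abs γ).symm
  have hg0 := abs_nonneg γ
  split_ifs with h
  · rcases lt_or_ge |γ| 1 with h1 | h1
    · have hk1 : k ≤ 2 / 3 := by
        have h2 : k ≤ ∫ y in (3 / 2 : ℝ)..(2 * T), (y ^ 2)⁻¹ := by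
          refine intervalIntegral.integral_mono_on hab (hcont γ).intervalIntegrable ?_ fun y hy => ?_
          · simpa using (hcont 0).intervalIntegrable
          · have : 0 < y := by linarith [hy.1]
            gcongr
            nlinarith
        have h3 : ∫ y in (3 / 2 : ℝ)..(2 * T), (y ^ 2)⁻¹ = -(2 * T)⁻¹ - -(3 / 2 : ℝ)⁻¹ := by
          refine intervalIntegral.integral_eq_sub_of_hasDerivAt (f := fun y => -y⁻¹) (fun y hy => ?_) ?_
          · rw [Set.uIcc_of_le hab] at hy
            have : y ≠ 0 := by linarith [hy.1]
            simpa using (hasDerivAt_inv this).fun_neg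
          · simpa using (hcont 0).intervalIntegrable
        have : 0 < (2 * T)⁻¹ := by positivity
        linarith
      have hw : 1 / Real.sqrt (1 / 4 + γ ^ 2) ≤ 2 := by
        rw [div_le_iff₀ (by positivity)]
        have : (1 / 2 : ℝ) ≤ Real.sqrt (1 / 4 + γ ^ 2) := Real.le_sqrt_of_sq_le (by nlinarith)
        linarith
      have hw0 : 0 ≤ 1 / Real.sqrt (1 / 4 + γ ^ 2) := by positivity
      have h4 : 2 ≤ 10 * (3 / 2 / ((3 / 2) ^ 2 + γ ^ 2)) := by
        rw [mul_div_assoc', le_div_iff₀ (by positivity)]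
        nlinarith
      have h5 : 2 / Real.pi * k ≤ 2 / 3 * (2 / 3) := by gcongr
      have h6 : 0 ≤ 2 / Real.pi * k := by positivity
      rw [abs_le]; constructor <;> linarith
    · have hk1 : k = (Real.arctan (2 * T / |γ|) - Real.arctan (3 / 2 / |γ|)) / |γ| := by
        rw [hk, hg2]
        have h2 := intervalIntegral.integral_eq_sub_of_hasDerivAt (a := 3 / 2) (b := 2 * T)
          (f := fun y => Real.arctan (y / |γ|) / |γ|)
          (f' := fun y => (y ^ 2 + |γ| ^ 2)⁻¹) (fun y hy => ?_) (hcont |γ|).intervalIntegrable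
        · rw [h2]; ring
        · have h3 := (((hasDerivAt_id y).div_const |γ|).arctan).div_const |γ|
          have h4 : (1 / (1 + (id y / |γ|) ^ 2) * (1 / |γ|) / |γ| : ℝ) = (y ^ 2 + |γ| ^ 2)⁻¹ := by
            simp only [id]
            field_simp
            ring
          rwa [h4] at h3
      have ha1 : Real.arctan (3 / 2 / |γ|) ≤ 3 / 2 / |γ| := Real.arctan_le_of_nonneg (by positivity)
      have ha0 : 0 ≤ Real.arctan (3 / 2 / |γ|) := Real.arctan_nonneg.2 (by positivity)
      have hb : Real.arctan (2 * T / |γ|) = Real.pi / 2 - Real.arctan (|γ| / (2 * T)) := by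
        rw [← Real.arctan_inv_of_pos (by positivity), inv_div]
      have hb1 : Real.arctan (|γ| / (2 * T)) ≤ |γ| / (2 * T) := Real.arctan_le_of_nonneg (by positivity)
      have hb0 : 0 ≤ Real.arctan (|γ| / (2 * T)) := Real.arctan_nonneg.2 (by positivity)
      set a := Real.arctan (3 / 2 / |γ|)
      set b := Real.arctan (|γ| / (2 * T))
      have hk2 : 2 / Real.pi * k = 1 / |γ| - 2 / Real.pi * ((a + b) / |γ|) := by
        rw [hk1, hb]; field_simp; ring
      have h7 : (a + b) / |γ| ≤ 3 / 2 / |γ| ^ 2 + 1 / (2 * T) := by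
        rw [div_le_iff₀ (by positivity)]
        calc a + b ≤ 3 / 2 / |γ| + |γ| / (2 * T) := add_le_add ha1 hb1
          _ = _ := by field_simp
      have h7' : 0 ≤ (a + b) / |γ| := by positivity
      have h8 : 2 / Real.pi * ((a + b) / |γ|) ≤ 2 / 3 * (3 / 2 / |γ| ^ 2 + 1 / (2 * T)) := by gcongr
      have h8' : 0 ≤ 2 / Real.pi * ((a + b) / |γ|) := by positivity
      have h9 : 1 / Real.sqrt (1 / 4 + γ ^ 2) ≤ 1 / |γ| := by
        gcongr
        exact Real.le_sqrt_of_sq_le (by rw [hg2]; linarith)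
      have h10 : 1 / |γ| - 1 / |γ| ^ 2 ≤ 1 / Real.sqrt (1 / 4 + γ ^ 2) := by
        have : Real.sqrt (1 / 4 + γ ^ 2) ≤ |γ| + 1 := by
          rw [Real.sqrt_le_left (by positivity)]; nlinarith
        have h11 : 1 / (|γ| + 1) ≤ 1 / Real.sqrt (1 / 4 + γ ^ 2) := by gcongr
        refine le_trans ?_ h11
        rw [div_sub_div _ _ (by positivity) (by positivity), div_le_div_iff₀ (by positivity) (by positivity)]
        nlinarith
      have h12 : 1 / |γ| ^ 2 ≤ 3 * (3 / 2 / ((3 / 2) ^ 2 + γ ^ 2)) := by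
        rw [hg2, mul_div_assoc', div_le_div_iff₀ (by positivity) (by positivity)]
        nlinarith
      have h13 : 1 / (2 * T) ≤ 2 * (2 * T / ((2 * T) ^ 2 + γ ^ 2)) := by
        rw [hg2, mul_div_assoc', div_le_div_iff₀ (by positivity) (by positivity)]
        nlinarith
      have h14 : 3 / 2 / |γ| ^ 2 = 3 / 2 * (1 / |γ| ^ 2) := by ring
      rw [hk2, abs_le]; constructor <;> linarith
  · have hTg : T ≤ |γ| := not_lt.1 h
    have h1 : k ≤ 2 * T * (1 / |γ| ^ 2) := by
      have h2 : k ≤ ∫ y in (3 / 2 : ℝ)..(2 * T), 1 / |γ| ^ 2 := by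
        refine intervalIntegral.integral_mono_on hab (hcont γ).intervalIntegrable
          intervalIntegrable_const fun y hy => ?_
        rw [inv_eq_one_div, hg2]
        have : 0 < |γ| := by linarith
        gcongr
        nlinarith
      rw [intervalIntegral.integral_const, smul_eq_mul] at h2
      refine h2.trans ?_
      gcongr
      linarith
    have h2 : 2 * T * (1 / |γ| ^ 2) ≤ 5 * (2 * T / ((2 * T) ^ 2 + γ ^ 2)) := by
      have : 0 < |γ| := by linarith
      rw [hg2, mul_div_assoc', mul_div_assoc', div_le_div_iff₀ (by positivity) (by positivity)]
      nlinarith [mul_le_mul hTg hTg (by linarith) hg0]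
    have h3 : 2 / Real.pi * k ≤ 2 / 3 * k := by gcongr
    have h4 : 0 ≤ 2 / Real.pi * k := by positivity
    rw [zero_sub, abs_neg, abs_of_nonneg h4]
    linarith

theorem abs_two_div_pi_mul_sub_le {x t u v : ℝ} (hx : 1 ≤ x) (ht : 0 ≤ t) (hv : 1 ≤ v)
    (hvu : v ≤ 2 * u) (hu : u ≤ 1) :
    |2 / Real.pi * (1 / 4 * (x + (u + t)) ^ 2 - 1 / 4 * (x + (v - u)) ^ 2) -
    1 / Real.pi * (x + t / 2) * t| ≤ 2 / 3 * (3 * (x + t)) := by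
  have hpi := Real.pi_gt_three
  have hpi2 : 2 / Real.pi ≤ 2 / 3 := by gcongr
  have hpi0 : 0 ≤ 2 / Real.pi := by positivity
  have h1 : 2 / Real.pi * (1 / 4 * (x + (u + t)) ^ 2 - 1 / 4 * (x + (v - u)) ^ 2) -
    1 / Real.pi * (x + t / 2) * t =
    2 / Real.pi * (1 / 4 * (v * t + (2 * u - v) * (2 * x + t + v))) := by ring
  have h2 : v ≤ 2 := by linarith
  have h3 : 0 ≤ 2 * u - v := by linarith
  have h4 : 2 * u - v ≤ 1 := by linarith
  have h5 : v * t ≤ 2 * t := by gcongr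
  have h6 : (2 * u - v) * (2 * x + t + v) ≤ 1 * (2 * x + t + v) := by
    apply mul_le_mul_of_nonneg_right h4; linarith
  have h7 : 0 ≤ v * t := by positivity
  have h8 : 0 ≤ (2 * u - v) * (2 * x + t + v) := mul_nonneg h3 (by linarith)
  rw [h1, abs_mul, abs_of_nonneg hpi0, abs_of_nonneg (by positivity)]
  refine mul_le_mul hpi2 (by linarith) (by positivity) (by norm_num)

theorem abs_sum_low_sub_le {C₀ : ℝ} (hC₀ : 0 ≤ C₀) {q T : ℝ} (hq : 3 ≤ q) (hT : 1 ≤ T)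
    (Z : Finset ℝ) (m : ℝ → ℝ) (hm : ∀ γ, 0 ≤ m γ)
    (h : ∀ y : ℝ, 3 / 2 ≤ y → y ≤ 2 * T →
      |∑ γ ∈ Z, m γ * (y / (y ^ 2 + γ ^ 2)) - 1 / 2 * Real.log (q * y)| ≤ C₀) :
    |∑ γ ∈ Z, (if |γ| < T then m γ / Real.sqrt (1 / 4 + γ ^ 2) else 0) -
      1 / Real.pi * Real.log (q * Real.sqrt T) * Real.log T| ≤ 30 * (1 + C₀) * Real.log (q * T) := by
  have hab : (3 / 2 : ℝ) ≤ 2 * T := by linarith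
  have hpi := Real.pi_gt_three
  have hpi2 : 2 / Real.pi ≤ 2 / 3 := by gcongr
  have hpi0 : 0 ≤ 2 / Real.pi := by positivity
  have hpos : ∀ y ∈ Set.uIcc (3 / 2) (2 * T), 0 < y := by
    intro y hy
    rw [Set.uIcc_of_le hab] at hy
    linarith [hy.1]
  have hcont : ∀ (δ : ℝ), ContinuousOn (fun y : ℝ => (y ^ 2 + δ ^ 2)⁻¹) (Set.uIcc (3 / 2) (2 * T)) := by
    intro δ
    refine ContinuousOn.inv₀ (by fun_prop) fun y hy => ?_
    have := hpos y hy
    positivity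
  set k : ℝ → ℝ := fun γ => ∫ y in (3 / 2 : ℝ)..(2 * T), (y ^ 2 + γ ^ 2)⁻¹ with hk
  set F : ℝ → ℝ := fun y => ∑ γ ∈ Z, m γ * (y / (y ^ 2 + γ ^ 2)) with hF
  have hsum : |∑ γ ∈ Z, (if |γ| < T then m γ / Real.sqrt (1 / 4 + γ ^ 2) else 0) -
      2 / Real.pi * ∑ γ ∈ Z, m γ * k γ| ≤ 10 * (F (3 / 2) + F (2 * T)) := by
    have h1 : ∑ γ ∈ Z, (if |γ| < T then m γ / Real.sqrt (1 / 4 + γ ^ 2) else 0) -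
        2 / Real.pi * ∑ γ ∈ Z, m γ * k γ = ∑ γ ∈ Z, m γ *
          ((if |γ| < T then 1 / Real.sqrt (1 / 4 + γ ^ 2) else 0) - 2 / Real.pi * k γ) := by
      rw [Finset.mul_sum, ← Finset.sum_sub_distrib]
      refine Finset.sum_congr rfl fun γ _ => ?_
      split_ifs <;> ring
    have h2 : 10 * (F (3 / 2) + F (2 * T)) = ∑ γ ∈ Z, m γ *
        (10 * ((3 / 2) / ((3 / 2) ^ 2 + γ ^ 2) + 2 * T / ((2 * T) ^ 2 + γ ^ 2))) := by
      simp only [hF]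
      rw [← Finset.sum_add_distrib, Finset.mul_sum]
      exact Finset.sum_congr rfl fun γ _ => by ring
    rw [h1, h2]
    refine (Finset.abs_sum_le_sum_abs _ _).trans (Finset.sum_le_sum fun γ _ => ?_)
    rw [abs_mul, abs_of_nonneg (hm γ)]
    exact mul_le_mul_of_nonneg_left (abs_indicator_sub_integral_inv_sq_add_sq_le hT) (hm γ)
  have hkint : ∑ γ ∈ Z, m γ * k γ = ∫ y in (3 / 2 : ℝ)..(2 * T), F y / y := by
    simp only [hk]
    simp_rw [← intervalIntegral.integral_const_mul]
    rw [← intervalIntegral.integral_finsetSum]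
    · refine intervalIntegral.integral_congr fun y hy => ?_
      have := hpos y hy
      simp only [hF, Finset.sum_div]
      refine Finset.sum_congr rfl fun γ _ => ?_
      field_simp
    · exact fun γ _ => ((hcont γ).intervalIntegrable).const_mul _
  have hFc : ContinuousOn (fun y => F y / y) (Set.uIcc (3 / 2) (2 * T)) := by
    refine ContinuousOn.div ?_ continuousOn_id fun y hy => (hpos y hy).ne'
    refine continuousOn_finsetSum _ fun γ _ => ?_
    exact continuousOn_const.mul (continuousOn_id.mul (hcont γ))
  have hlc : ContinuousOn (fun y => 1 / 2 * Real.log (q * y) / y) (Set.uIcc (3 / 2) (2 * T)) := by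
    refine ContinuousOn.div (continuousOn_const.mul (ContinuousOn.log (by fun_prop) fun y hy => ?_))
      continuousOn_id fun y hy => (hpos y hy).ne'
    have := hpos y hy
    positivity
  have hic : ContinuousOn (fun y => C₀ / y) (Set.uIcc (3 / 2) (2 * T)) :=
    continuousOn_const.div continuousOn_id fun y hy => (hpos y hy).ne'
  have hdiff : |(∫ y in (3 / 2 : ℝ)..(2 * T), F y / y) -
      ∫ y in (3 / 2 : ℝ)..(2 * T), 1 / 2 * Real.log (q * y) / y| ≤ C₀ * Real.log (2 * T / (3 / 2)) := by
    rw [← intervalIntegral.integral_sub hFc.intervalIntegrable hlc.intervalIntegrable,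
      ← integral_inv_of_pos (by norm_num) (by linarith), ← intervalIntegral.integral_const_mul]
    refine (intervalIntegral.abs_integral_le_integral_abs hab).trans
      (intervalIntegral.integral_mono_on hab (hFc.sub hlc).abs.intervalIntegrable
        hic.intervalIntegrable fun y hy => ?_)
    have hy0 : 0 < y := by linarith [hy.1]
    rw [← sub_div, abs_div, abs_of_pos hy0, ← div_eq_mul_inv]
    exact div_le_div_of_nonneg_right (h y hy.1 hy.2) hy0.le
  have hint : ∫ y in (3 / 2 : ℝ)..(2 * T), 1 / 2 * Real.log (q * y) / y =
      1 / 4 * Real.log (q * (2 * T)) ^ 2 - 1 / 4 * Real.log (q * (3 / 2)) ^ 2 := by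
    refine intervalIntegral.integral_eq_sub_of_hasDerivAt
      (f := fun y => 1 / 4 * Real.log (q * y) ^ 2) (fun y hy => ?_) hlc.intervalIntegrable
    have hy0 := hpos y hy
    have h1 := ((((hasDerivAt_id y).const_mul q).log (by simp only [id]; positivity)).fun_pow 2).const_mul (1 / 4)
    have h2 : (1 / 4 * (((2 : ℕ) : ℝ) * Real.log (q * id y) ^ (2 - 1) * (q * 1 / (q * id y))) : ℝ) =
        1 / 2 * Real.log (q * y) / y := by
      simp only [id]
      field_simp
      norm_num
      ring
    rw [← h2]
    exact h1
  have hq0 : q ≠ 0 := by linarith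
  have hT0 : T ≠ 0 := by linarith
  have e1 : Real.log (q * (2 * T)) = Real.log q + (Real.log 2 + Real.log T) := by
    rw [Real.log_mul hq0 (by simpa), Real.log_mul (by norm_num) hT0]
  have e2 : Real.log (q * (3 / 2)) = Real.log q + (Real.log 3 - Real.log 2) := by
    rw [Real.log_mul hq0 (by norm_num), Real.log_div (by norm_num) (by norm_num)]
  have e3 : Real.log (2 * T / (3 / 2)) = Real.log 2 + Real.log T - (Real.log 3 - Real.log 2) := by
    rw [Real.log_div (by simpa) (by norm_num), Real.log_mul (by norm_num) hT0,
      Real.log_div (by norm_num) (by norm_num)]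
  have e4 : Real.log (q * Real.sqrt T) = Real.log q + Real.log T / 2 := by
    rw [Real.log_mul hq0 (Real.sqrt_ne_zero'.2 (by linarith)), Real.log_sqrt (by linarith)]
  have e5 : Real.log (q * T) = Real.log q + Real.log T := Real.log_mul hq0 hT0
  have l3 : 1 ≤ Real.log 3 := by
    rw [Real.le_log_iff_exp_le (by norm_num)]
    linarith [Real.exp_one_lt_d9]
  have l2 : 0 < Real.log 2 := Real.log_pos (by norm_num)
  have l32 : Real.log 2 ≤ Real.log 3 := Real.log_le_log (by norm_num) (by norm_num)
  have lq : Real.log 3 ≤ Real.log q := Real.log_le_log (by norm_num) hq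
  have lT : 0 ≤ Real.log T := Real.log_nonneg hT
  have l22 : Real.log 3 ≤ 2 * Real.log 2 := by
    rw [← Real.log_rpow (by norm_num)]
    exact Real.log_le_log (by norm_num) (by norm_num)
  have l2' : Real.log 2 ≤ 1 := by linarith [Real.log_two_lt_d9]
  have hF1 := h (3 / 2) le_rfl hab
  have hF2 := h (2 * T) hab le_rfl
  rw [e2] at hF1
  rw [e1] at hF2
  rw [hint, e1, e2, e3, ← hkint] at hdiff
  rw [e4, e5]
  set x := Real.log q
  set t := Real.log T
  set u := Real.log 2
  set v := Real.log 3
  have hF1' := (abs_le.1 hF1).2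
  have hF2' := (abs_le.1 hF2).2
  have hd' : |2 / Real.pi * ∑ γ ∈ Z, m γ * k γ -
      2 / Real.pi * (1 / 4 * (x + (u + t)) ^ 2 - 1 / 4 * (x + (v - u)) ^ 2)| ≤
      2 / 3 * (C₀ * (u + t - (v - u))) := by
    rw [← mul_sub, abs_mul, abs_of_nonneg hpi0]
    have := (abs_nonneg _).trans hdiff
    gcongr
  have hmain := abs_two_div_pi_mul_sub_le (by linarith : 1 ≤ x) lT (by linarith) l22 (by linarith)
  have hx1 : C₀ * 1 ≤ C₀ * (x + t) := mul_le_mul_of_nonneg_left (by linarith) hC₀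
  have hx2 : C₀ * (u + t - (v - u)) ≤ C₀ * (x + t) := mul_le_mul_of_nonneg_left (by linarith) hC₀
  have hfin : 10 * (F (3 / 2) + F (2 * T)) ≤ 10 * (2 * C₀ + 2 * (x + t)) := by
    simp only [hF]; linarith
  clear_value F k
  have htot : 10 * (2 * C₀ + 2 * (x + t)) + 2 / 3 * (C₀ * (u + t - (v - u))) +
      2 / 3 * (3 * (x + t)) ≤ 30 * (1 + C₀) * (x + t) := by linarith
  rw [abs_le] at hsum hd' hmain ⊢
  constructor
  · linarith [hsum.1, hd'.1, hmain.1]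
  · linarith [hsum.2, hd'.2, hmain.2]

theorem Complex.re_digamma_ofReal_mem_Icc {x : ℝ} (hx : 0 < x) :
    (Complex.digamma x).re ∈ Set.Icc (Real.log x - x⁻¹) (Real.log x) := by
  have hne : ∀ {x : ℝ}, 0 < x → ∀ m : ℕ, (x : ℂ) ≠ -m := by
    intro x hx m h
    have := congrArg Complex.re h
    simp at this
    have : (0 : ℝ) ≤ m := Nat.cast_nonneg m
    linarith
  have hd : ∀ {x : ℝ}, 0 < x →
      HasDerivAt (Real.log ∘ Real.Gamma) (Complex.digamma x).re x := by
    intro x hx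
    have h1 := (Complex.differentiableAt_Gamma x (hne hx)).hasDerivAt.real_of_complex
    have h2 : (fun x : ℝ => (Complex.Gamma x).re) = Real.Gamma := by
      ext y; rw [Complex.Gamma_ofReal, Complex.ofReal_re]
    rw [h2] at h1
    have h3 := h1.log (Real.Gamma_pos_of_pos hx).ne'
    rw [Complex.digamma_def, logDeriv_apply, Complex.Gamma_ofReal, Complex.div_ofReal_re]
    exact h3
  have hx1 : 0 < x + 1 := by linarith
  have hslope : slope (Real.log ∘ Real.Gamma) x (x + 1) = Real.log x := by
    rw [slope_def_field]
    simp only [Function.comp_apply, add_sub_cancel_left, div_one]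
    rw [Real.Gamma_add_one hx.ne', Real.log_mul hx.ne' (Real.Gamma_pos_of_pos hx).ne']
    ring
  constructor
  · have h1 := Real.convexOn_log_Gamma.slope_le_of_hasDerivAt hx hx1 (by linarith) (hd hx1)
    rw [hslope] at h1
    have h2 := congrArg Complex.re (Complex.digamma_apply_add_one x (hne hx))
    push_cast at h1
    rw [h2, Complex.add_re, ← Complex.ofReal_inv, Complex.ofReal_re] at h1
    linarith
  · have h1 := Real.convexOn_log_Gamma.le_slope_of_hasDerivAt hx hx1 (by linarith) (hd hx)
    rwa [hslope] at h1

theorem Complex.differentiableAt_Gammaℝ {s : ℂ} (hs : 0 < s.re) : DifferentiableAt ℂ Complex.Gammaℝ s := by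
  have h0 : ∀ m : ℕ, s / 2 ≠ -m := by
    intro m h
    have h1 := congrArg Complex.re h
    simp at h1
    have : (0 : ℝ) ≤ m := Nat.cast_nonneg m
    linarith
  have hG : DifferentiableAt ℂ (fun s : ℂ => Complex.Gamma (s / 2)) s :=
    (Complex.differentiableAt_Gamma (s / 2) h0).comp s (by fun_prop)
  have hpi : (Real.pi : ℂ) ≠ 0 := by exact_mod_cast Real.pi_ne_zero
  have hP : DifferentiableAt ℂ (fun s : ℂ => (Real.pi : ℂ) ^ (-s / 2)) s := by
    apply DifferentiableAt.const_cpow (by fun_prop) (Or.inl hpi)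
  have : Complex.Gammaℝ = fun s => (Real.pi : ℂ) ^ (-s / 2) * Complex.Gamma (s / 2) := by
    ext s; exact Complex.Gammaℝ_def s
  rw [this]
  exact hP.mul hG

theorem Complex.logDeriv_Gammaℝ {s : ℂ} (hs : 0 < s.re) :
    logDeriv Complex.Gammaℝ s = -(Real.log Real.pi / 2 : ℝ) + Complex.digamma (s / 2) / 2 := by
  have h0 : ∀ m : ℕ, s / 2 ≠ -m := by
    intro m h
    have h1 := congrArg Complex.re h
    simp at h1
    have : (0 : ℝ) ≤ m := Nat.cast_nonneg m
    linarith
  have hpi : (Real.pi : ℂ) ≠ 0 := by exact_mod_cast Real.pi_ne_zero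
  have hG : HasDerivAt (fun s : ℂ => Complex.Gamma (s / 2)) (deriv Complex.Gamma (s / 2) * (1 / 2)) s :=
    (Complex.differentiableAt_Gamma (s / 2) h0).hasDerivAt.comp s ((hasDerivAt_id s).div_const 2)
  have hP : HasDerivAt (fun s : ℂ => (Real.pi : ℂ) ^ (-s / 2))
      ((Real.pi : ℂ) ^ (-s / 2) * Complex.log Real.pi * (-1 / 2)) s :=
    ((hasDerivAt_id s).neg.div_const 2).const_cpow (c := (Real.pi : ℂ)) (Or.inl hpi)
  have h1 : Complex.Gammaℝ = fun s => (Real.pi : ℂ) ^ (-s / 2) * Complex.Gamma (s / 2) := by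
    ext s; exact Complex.Gammaℝ_def s
  have h2 : (Real.pi : ℂ) ^ (-s / 2) ≠ 0 := by simp [Complex.cpow_eq_zero_iff, hpi]
  have h3 : Complex.Gamma (s / 2) ≠ 0 := Complex.Gamma_ne_zero h0
  rw [h1, logDeriv_mul s h2 h3 hP.differentiableAt hG.differentiableAt, logDeriv_apply,
    logDeriv_apply, Complex.digamma_def, logDeriv_apply, Complex.ofReal_div,
    Complex.ofReal_log Real.pi_pos.le, hP.deriv, hG.deriv]
  field_simp
  simp
  ring

theorem Complex.abs_re_logDeriv_Gammaℝ_sub_le {y σ : ℝ} (hσ : 2 ≤ σ) (hyσ : y ≤ σ) (hσy : σ ≤ 2 * y) :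
    |(logDeriv Complex.Gammaℝ σ).re - 1 / 2 * Real.log y| ≤ 2 := by
  have hy0 : 0 < y := by linarith
  rw [Complex.logDeriv_Gammaℝ (by simpa using (by linarith : 0 < σ))]
  have h1 := Complex.re_digamma_ofReal_mem_Icc (x := σ / 2) (by linarith)
  push_cast at h1
  have h2 : Real.log (σ / 2) ≤ Real.log y := Real.log_le_log (by linarith) (by linarith)
  have h3 : Real.log y - Real.log 2 ≤ Real.log (σ / 2) := by
    rw [← Real.log_div hy0.ne' (by norm_num)]
    exact Real.log_le_log (by linarith) (by linarith)
  have h4 : (σ / 2)⁻¹ ≤ 1 := inv_le_one_of_one_le₀ (by linarith)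
  have h5 : Real.log Real.pi ≤ 2 := by
    have : Real.log Real.pi ≤ Real.log (2 * 2) := Real.log_le_log Real.pi_pos (by linarith [Real.pi_le_four])
    rw [Real.log_mul (by norm_num) (by norm_num)] at this
    linarith [Real.log_two_lt_d9]
  have h6 : 0 ≤ Real.log Real.pi := Real.log_nonneg (by linarith [Real.pi_gt_three])
  have h7 := Real.log_two_lt_d9
  have h8 : (Complex.digamma (σ / 2) / 2).re = (Complex.digamma (σ / 2)).re / 2 := by
    simp
  rw [Complex.add_re, Complex.neg_re, Complex.ofReal_re, h8, abs_le]
  constructor <;> linarith [h1.1, h1.2]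

namespace DirichletCharacter

theorem exists_norm_logDeriv_LFunction_le :
    ∃ A : ℝ, 0 ≤ A ∧ ∀ (N : ℕ) [NeZero N] (χ : DirichletCharacter ℂ N) (s : ℂ), 2 ≤ s.re →
      ‖logDeriv (LFunction χ) s‖ ≤ A := by
  have hsum : Summable fun n => ‖LSeries.term (fun n => (ArithmeticFunction.vonMangoldt n : ℂ)) 2 n‖ :=
    (ArithmeticFunction.LSeriesSummable_vonMangoldt (s := 2) (by norm_num)).norm
  refine ⟨∑' n, ‖LSeries.term (fun n => (ArithmeticFunction.vonMangoldt n : ℂ)) 2 n‖,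
    tsum_nonneg fun _ => norm_nonneg _, fun N _ χ s hs => ?_⟩
  have hs1 : 1 < s.re := by linarith
  have h1 := LSeries_twist_vonMangoldt_eq χ hs1
  have h2 : logDeriv (LFunction χ) s = deriv (LSeries (fun n => χ n)) s / LSeries (fun n => χ n) s := by
    rw [logDeriv_apply, deriv_LFunction_eq_deriv_LSeries χ hs1, LFunction_eq_LSeries χ hs1]
  rw [h2, ← norm_neg, ← neg_div, ← h1, LSeries]
  refine tsum_of_norm_bounded hsum.hasSum fun n => ?_
  refine (LSeries.norm_term_le (g := fun n => (ArithmeticFunction.vonMangoldt n : ℂ)) s ?_).trans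
    (LSeries.norm_term_le_of_re_le_re _ (by simpa using hs) n)
  simp only [Pi.mul_apply, norm_mul]
  exact mul_le_of_le_one_left (norm_nonneg _) (χ.norm_le_one _)

variable {N : ℕ}

theorem gammaFactor_eq (χ : DirichletCharacter ℂ N) :
    ∃ a : ℝ, (a = 0 ∨ a = 1) ∧ gammaFactor χ = fun s => Complex.Gammaℝ (s + a) := by
  rcases χ.even_or_odd with h | h
  · exact ⟨0, Or.inl rfl, by ext s; simp [h.gammaFactor_def]⟩
  · exact ⟨1, Or.inr rfl, by ext s; simp [h.gammaFactor_def]⟩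

theorem differentiableAt_gammaFactor (χ : DirichletCharacter ℂ N) {s : ℂ} (hs : 0 < s.re) :
    DifferentiableAt ℂ (gammaFactor χ) s := by
  obtain ⟨a, ha, h⟩ := χ.gammaFactor_eq
  rw [h]
  refine DifferentiableAt.comp (g := Complex.Gammaℝ) s (Complex.differentiableAt_Gammaℝ ?_) (by fun_prop)
  rcases ha with rfl | rfl <;> simp <;> linarith

theorem gammaFactor_ne_zero (χ : DirichletCharacter ℂ N) {s : ℂ} (hs : 0 < s.re) :
    gammaFactor χ s ≠ 0 := by
  obtain ⟨a, ha, h⟩ := χ.gammaFactor_eq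
  rw [h]
  refine Complex.Gammaℝ_ne_zero_of_re_pos ?_
  rcases ha with rfl | rfl <;> simp <;> linarith

theorem abs_re_logDeriv_gammaFactor_sub_le (χ : DirichletCharacter ℂ N) {y : ℝ} (hy : 3 / 2 ≤ y) :
    |(logDeriv (gammaFactor χ) (1 / 2 + y)).re - 1 / 2 * Real.log y| ≤ 2 := by
  obtain ⟨a, ha, h⟩ := χ.gammaFactor_eq
  have ha' : 0 ≤ a ∧ a ≤ 1 := by rcases ha with rfl | rfl <;> norm_num
  have h1 : logDeriv (gammaFactor χ) (1 / 2 + y) = logDeriv Complex.Gammaℝ ((1 / 2 + y + a : ℝ) : ℂ) := by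
    rw [h, logDeriv_apply, logDeriv_apply, deriv_comp_add_const]
    push_cast
    rfl
  rw [h1]
  exact Complex.abs_re_logDeriv_Gammaℝ_sub_le (by linarith) (by linarith) (by linarith)

variable [NeZero N]

theorem completedLFunction_eq_gammaFactor_mul (χ : DirichletCharacter ℂ N) {s : ℂ} (hs : 0 < s.re) :
    completedLFunction χ s = gammaFactor χ s * LFunction χ s := by
  rw [LFunction_eq_completed_div_gammaFactor χ s (Or.inl (by rintro rfl; simp at hs)),
    mul_div_cancel₀ _ (gammaFactor_ne_zero χ hs)]

theorem completedLFunction_eventuallyEq (χ : DirichletCharacter ℂ N) {s : ℂ} (hs : 0 < s.re) :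
    completedLFunction χ =ᶠ[𝓝 s] gammaFactor χ * LFunction χ := by
  filter_upwards [(isOpen_lt continuous_const Complex.continuous_re).mem_nhds hs] with z hz
  exact completedLFunction_eq_gammaFactor_mul χ hz

theorem exists_abs_re_logDeriv_completedLFunction_sub_le :
    ∃ A : ℝ, 0 ≤ A ∧ ∀ (N : ℕ) [NeZero N] (χ : DirichletCharacter ℂ N) (y : ℝ), 3 / 2 ≤ y →
      |(logDeriv (completedLFunction χ) (1 / 2 + y)).re - 1 / 2 * Real.log y| ≤ A := by
  obtain ⟨A, hA0, hA⟩ := exists_norm_logDeriv_LFunction_le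
  refine ⟨2 + A, by linarith, fun N _ χ y hy => ?_⟩
  have hre : (1 / 2 + (y : ℂ)).re = 1 / 2 + y := by simp
  have hs : 0 < (1 / 2 + (y : ℂ)).re := by rw [hre]; linarith
  have hs2 : 2 ≤ (1 / 2 + (y : ℂ)).re := by rw [hre]; linarith
  have hs1 : 1 < (1 / 2 + (y : ℂ)).re := by linarith
  have hL : LFunction χ (1 / 2 + y) ≠ 0 := by
    rw [LFunction_eq_LSeries χ hs1]
    exact LSeries_ne_zero_of_one_lt_re χ hs1
  have h1 : logDeriv (completedLFunction χ) (1 / 2 + y) =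
      logDeriv (gammaFactor χ) (1 / 2 + y) + logDeriv (LFunction χ) (1 / 2 + y) := by
    have h2 := completedLFunction_eventuallyEq χ hs
    rw [logDeriv_apply, h2.deriv_eq, h2.eq_of_nhds, ← logDeriv_apply]
    exact logDeriv_mul _ (gammaFactor_ne_zero χ hs) hL (differentiableAt_gammaFactor χ hs)
      (differentiableAt_LFunction χ _ (Or.inl (by intro h; rw [h] at hs1; simp at hs1)))
  rw [h1, Complex.add_re]
  have h3 := (Complex.abs_re_le_norm _).trans (hA N χ _ hs2)
  have h4 := abs_re_logDeriv_gammaFactor_sub_le χ hy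
  rw [abs_le] at *
  constructor <;> linarith [h3.1, h3.2, h4.1, h4.2]

end DirichletCharacter

open ComplexConjugate in
theorem Complex.Gammaℝ_conj (s : ℂ) : Complex.Gammaℝ (conj s) = conj (Complex.Gammaℝ s) := by
  have h : (Real.pi : ℂ) ^ (-conj s / 2) = conj ((Real.pi : ℂ) ^ (-s / 2)) := by
    have h1 : -conj s / 2 = conj (-s / 2) := by simp [Complex.conj_ofNat]
    rw [h1, Complex.cpow_conj _ _ (by rw [Complex.arg_ofReal_of_nonneg Real.pi_pos.le]; exact Real.pi_ne_zero.symm),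
      Complex.conj_ofReal]
  have h2 : conj s / 2 = conj (s / 2) := by simp [Complex.conj_ofNat]
  rw [Complex.Gammaℝ_def, Complex.Gammaℝ_def, h, h2, Complex.Gamma_conj, map_mul]

namespace DirichletCharacter

open ComplexConjugate

theorem gammaFactor_inv_conj {N : ℕ} (χ : DirichletCharacter ℂ N) (s : ℂ) :
    gammaFactor χ⁻¹ (conj s) = conj (gammaFactor χ s) := by
  rcases χ.even_or_odd with h | h
  · have h' : χ⁻¹.Even := by
      rw [DirichletCharacter.Even, ← MulChar.star_apply', h]; simp
    rw [h.gammaFactor_def, h'.gammaFactor_def, Complex.Gammaℝ_conj]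
  · have h' : χ⁻¹.Odd := by
      rw [DirichletCharacter.Odd, ← MulChar.star_apply', h]; simp
    rw [h.gammaFactor_def, h'.gammaFactor_def, ← Complex.Gammaℝ_conj]
    simp

variable {N : ℕ} [NeZero N]

theorem LFunction_inv_conj (χ : DirichletCharacter ℂ N) {s : ℂ} (hs : 1 < s.re) :
    LFunction χ⁻¹ (conj s) = conj (LFunction χ s) := by
  rw [LFunction_eq_LSeries χ hs, LFunction_eq_LSeries χ⁻¹ (by simpa using hs), LSeries, LSeries,
    Complex.conj_tsum]
  refine tsum_congr fun n => ?_
  rcases eq_or_ne n 0 with rfl | hn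
  · simp
  · rw [LSeries.term_of_ne_zero hn, LSeries.term_of_ne_zero hn, map_div₀, ← MulChar.star_apply',
      Complex.cpow_conj _ _ (by rw [Complex.natCast_arg]; exact Real.pi_ne_zero.symm), Complex.conj_natCast]
    rfl

theorem completedLFunction_inv_conj {χ : DirichletCharacter ℂ N} (hχ : χ ≠ 1) (s : ℂ) :
    completedLFunction χ⁻¹ (conj s) = conj (completedLFunction χ s) := by
  have hχ' : χ⁻¹ ≠ 1 := inv_ne_one.2 hχ
  have h1 : Differentiable ℂ (conj ∘ completedLFunction χ⁻¹ ∘ conj) := fun z => by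
    simpa using (differentiable_completedLFunction hχ' (conj z)).conj_conj
  have h2 : conj ∘ completedLFunction χ⁻¹ ∘ conj = completedLFunction χ := by
    refine AnalyticOnNhd.eq_of_eventuallyEq (z₀ := 2) (fun z _ => h1.analyticAt z)
      (fun z _ => (differentiable_completedLFunction hχ).analyticAt z) ?_
    filter_upwards [(isOpen_lt (continuous_const (y := (1 : ℝ))) Complex.continuous_re).mem_nhds
      (by simp : (2 : ℂ) ∈ {z : ℂ | 1 < z.re})] with z hz
    have hz0 : 0 < z.re := by linarith [show (1 : ℝ) < z.re from hz]
    simp only [Function.comp_apply]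
    rw [completedLFunction_eq_gammaFactor_mul χ hz0,
      completedLFunction_eq_gammaFactor_mul χ⁻¹ (by simpa using hz0), gammaFactor_inv_conj,
      LFunction_inv_conj χ hz]
    simp
  rw [← h2]
  simp

end DirichletCharacter

theorem exists_norm_mellin_le {E : Type*} [NormedAddCommGroup E] [NormedSpace ℂ E] {f : ℝ → E} {a b : ℝ}
    (ha : MellinConvergent f a) (hb : MellinConvergent f b) :
    ∃ B : ℝ, ∀ s : ℂ, a ≤ s.re → s.re ≤ b → ‖mellin f s‖ ≤ B := by
  have hnorm : ∀ (s : ℂ) (t : ℝ), 0 < t → ‖(t : ℂ) ^ (s - 1) • f t‖ = t ^ (s.re - 1) * ‖f t‖ :=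
    fun s t ht => by rw [norm_smul, Complex.norm_cpow_eq_rpow_re_of_pos ht]; simp
  refine ⟨∫ t in Set.Ioi (0 : ℝ), (‖(t : ℂ) ^ ((a : ℂ) - 1) • f t‖ + ‖(t : ℂ) ^ ((b : ℂ) - 1) • f t‖),
    fun s has hsb => ?_⟩
  refine norm_integral_le_of_norm_le (ha.norm.add hb.norm) ?_
  refine (ae_restrict_iff' measurableSet_Ioi).2 (Eventually.of_forall fun t (ht : 0 < t) => ?_)
  simp only [hnorm _ t ht, Complex.ofReal_re, ← add_mul]
  gcongr
  rcases le_total 1 t with h1 | h1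
  · exact (Real.rpow_le_rpow_of_exponent_le h1 (by linarith : s.re - 1 ≤ b - 1)).trans
      (le_add_of_nonneg_left (by positivity))
  · exact (Real.rpow_le_rpow_of_exponent_ge ht h1 (by linarith : a - 1 ≤ s.re - 1)).trans
      (le_add_of_nonneg_right (by positivity))

theorem IsStrongFEPair.exists_norm_Λ_le {E : Type*} [NormedAddCommGroup E] [NormedSpace ℂ E]
    [CompleteSpace E] {P : WeakFEPair E} (hP : IsStrongFEPair P) (a b : ℝ) :
    ∃ B : ℝ, ∀ s : ℂ, a ≤ s.re → s.re ≤ b → ‖P.Λ s‖ ≤ B := by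
  rw [hP.Λ_eq]
  exact exists_norm_mellin_le (hP.hasMellin a).1 (hP.hasMellin b).1

theorem WeakFEPair.exists_norm_Λ₀_le {E : Type*} [NormedAddCommGroup E] [NormedSpace ℂ E]
    [CompleteSpace E] (P : WeakFEPair E) (a b : ℝ) :
    ∃ B : ℝ, ∀ s : ℂ, a ≤ s.re → s.re ≤ b → ‖P.Λ₀ s‖ ≤ B :=
  exists_norm_mellin_le (P.isStrongFEPair_toStrongFEPair.hasMellin a).1
    (P.isStrongFEPair_toStrongFEPair.hasMellin b).1

theorem HurwitzZeta.exists_norm_completedHurwitzZetaEven₀_le (x : UnitAddCircle) (a b : ℝ) :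
    ∃ B : ℝ, ∀ s : ℂ, a ≤ s.re → s.re ≤ b → ‖HurwitzZeta.completedHurwitzZetaEven₀ x s‖ ≤ B := by
  obtain ⟨B, hB⟩ := (HurwitzZeta.hurwitzEvenFEPair x).exists_norm_Λ₀_le (a / 2) (b / 2)
  refine ⟨B / 2, fun s ha hb => ?_⟩
  rw [HurwitzZeta.completedHurwitzZetaEven₀, norm_div, Complex.norm_ofNat]
  gcongr
  exact hB _ (by simpa using by linarith) (by simpa using by linarith)

theorem HurwitzZeta.exists_norm_completedHurwitzZetaOdd_le (x : UnitAddCircle) (a b : ℝ) :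
    ∃ B : ℝ, ∀ s : ℂ, a ≤ s.re → s.re ≤ b → ‖HurwitzZeta.completedHurwitzZetaOdd x s‖ ≤ B := by
  obtain ⟨B, hB⟩ := (HurwitzZeta.isStrong_hurwitzOddFEPair x).exists_norm_Λ_le ((a + 1) / 2) ((b + 1) / 2)
  refine ⟨B / 2, fun s ha hb => ?_⟩
  rw [HurwitzZeta.completedHurwitzZetaOdd, norm_div, Complex.norm_ofNat]
  gcongr
  exact hB _ (by simpa using by linarith) (by simpa using by linarith)

theorem ZMod.exists_norm_completedLFunction₀_le {N : ℕ} [NeZero N] (Φ : ZMod N → ℂ) (a b : ℝ) (ha : 0 ≤ a) :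
    ∃ B : ℝ, ∀ s : ℂ, a ≤ s.re → s.re ≤ b → ‖ZMod.completedLFunction₀ Φ s‖ ≤ B := by
  choose B hB using fun j : ZMod N =>
    HurwitzZeta.exists_norm_completedHurwitzZetaEven₀_le (ZMod.toAddCircle j) a b
  choose D hD using fun j : ZMod N =>
    HurwitzZeta.exists_norm_completedHurwitzZetaOdd_le (ZMod.toAddCircle j) a b
  refine ⟨1 * ∑ j, ‖Φ j‖ * B j + 1 * ∑ j, ‖Φ j‖ * D j, fun s h1 h2 => ?_⟩
  have hN : ‖(N : ℂ) ^ (-s)‖ ≤ 1 := by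
    rw [Complex.norm_natCast_cpow_of_pos (NeZero.pos N)]
    exact Real.rpow_le_one_of_one_le_of_nonpos (by exact_mod_cast NeZero.one_le) (by simp; linarith)
  have aux : ∀ (G : ZMod N → ℂ) (M : ZMod N → ℝ), (∀ j, ‖G j‖ ≤ M j) →
      ‖(N : ℂ) ^ (-s) * ∑ j, Φ j * G j‖ ≤ 1 * ∑ j, ‖Φ j‖ * M j := fun G M hGM => by
    rw [norm_mul]
    gcongr
    refine norm_sum_le_of_le _ fun j _ => ?_
    rw [norm_mul]
    gcongr
    exact hGM j
  exact (norm_add_le _ _).trans (add_le_add (aux _ _ fun j => hB j s h1 h2) (aux _ _ fun j => hD j s h1 h2))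

namespace DirichletCharacter

variable {N : ℕ} [NeZero N]

theorem exists_norm_completedLFunction_le {χ : DirichletCharacter ℂ N} (hχ : χ ≠ 1) (b : ℝ) :
    ∃ B : ℝ, ∀ s : ℂ, 0 ≤ s.re → s.re ≤ b → ‖completedLFunction χ s‖ ≤ B := by
  obtain ⟨B, hB⟩ := ZMod.exists_norm_completedLFunction₀_le χ 0 b le_rfl
  have h0 : χ 0 = 0 := χ.map_zero' fun h => hχ (χ.level_one' h)
  refine ⟨B, fun s h1 h2 => ?_⟩
  rw [completedLFunction, ZMod.completedLFunction_eq, h0, χ.sum_eq_zero_of_ne_one hχ]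
  simpa using hB s h1 h2

theorem exists_norm_LFunction_le :
    ∃ A : ℝ, 0 ≤ A ∧ ∀ (N : ℕ) [NeZero N] (χ : DirichletCharacter ℂ N) (s : ℂ), 2 ≤ s.re →
      ‖LFunction χ s‖ ≤ A := by
  have hsum : Summable fun n => ‖LSeries.term (fun _ => 1) 2 n‖ :=
    (LSeriesSummable_one_iff.2 (by norm_num : 1 < (2 : ℂ).re)).norm
  refine ⟨∑' n, ‖LSeries.term (fun _ => 1) 2 n‖, tsum_nonneg fun _ => norm_nonneg _, fun N _ χ s hs => ?_⟩
  rw [LFunction_eq_LSeries χ (by linarith), LSeries]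
  refine tsum_of_norm_bounded hsum.hasSum fun n => ?_
  refine (LSeries.norm_term_le (g := fun _ => (1 : ℂ)) s ?_).trans
    (LSeries.norm_term_le_of_re_le_re _ (by simpa using hs) n)
  simpa using χ.norm_le_one _

end DirichletCharacter

theorem Complex.norm_Gamma_le_Gamma_re {s : ℂ} (hs : 0 < s.re) : ‖Complex.Gamma s‖ ≤ Real.Gamma s.re := by
  rw [Complex.Gamma_eq_integral hs, Real.Gamma_eq_integral hs, Complex.GammaIntegral]
  refine norm_integral_le_of_norm_le (Real.GammaIntegral_convergent hs) ?_
  refine (ae_restrict_iff' measurableSet_Ioi).2 (Eventually.of_forall fun t (ht : 0 < t) => ?_)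
  rw [norm_mul, Complex.norm_cpow_eq_rpow_re_of_pos ht, Complex.norm_real, Real.norm_of_nonneg (Real.exp_pos _).le]
  simp

theorem Real.Gamma_le_exp {x : ℝ} (hx : 2 ≤ x) : Real.Gamma x ≤ Real.exp (2 * (1 + x) ^ (3 / 2 : ℝ)) := by
  have hn : x ≤ ⌈x⌉₊ := Nat.le_ceil x
  have hn' : (⌈x⌉₊ : ℝ) ≤ 1 + x := by linarith [Nat.ceil_lt_add_one (by linarith : 0 ≤ x)]
  set n := ⌈x⌉₊
  have hnpos : (0 : ℝ) < n := by linarith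
  have h1 : Real.Gamma x ≤ n.factorial := by
    rw [← Real.Gamma_nat_eq_factorial]
    exact Real.Gamma_strictMonoOn_Ici.monotoneOn hx (by simp; linarith) (by linarith)
  have h2 : (n.factorial : ℝ) ≤ (n : ℝ) ^ n := by exact_mod_cast Nat.factorial_le_pow n
  refine (h1.trans h2).trans ?_
  rw [← Real.rpow_natCast, Real.rpow_def_of_pos hnpos]
  refine Real.exp_le_exp.2 ?_
  have h3 : Real.log n ≤ (n : ℝ) ^ (1 / 2 : ℝ) / (1 / 2) := Real.log_le_rpow_div hnpos.le (by norm_num)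
  calc Real.log n * n ≤ (n : ℝ) ^ (1 / 2 : ℝ) / (1 / 2) * n := by gcongr
    _ = 2 * (n : ℝ) ^ (3 / 2 : ℝ) := by
      rw [show (3 / 2 : ℝ) = 1 / 2 + 1 by norm_num, Real.rpow_add hnpos, Real.rpow_one]; ring
    _ ≤ _ := by gcongr

theorem Complex.norm_Gammaℝ_le {s : ℂ} (hs : 4 ≤ s.re) :
    ‖Complex.Gammaℝ s‖ ≤ Real.exp (2 * (1 + ‖s‖) ^ (3 / 2 : ℝ)) := by
  have h2 : (s / 2).re = s.re / 2 := by simp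
  rw [Complex.Gammaℝ_def, norm_mul, Complex.norm_cpow_eq_rpow_re_of_pos Real.pi_pos]
  have h1 : Real.pi ^ (-s / 2).re ≤ 1 :=
    Real.rpow_le_one_of_one_le_of_nonpos (by linarith [Real.pi_gt_three]) (by simp; linarith)
  refine (mul_le_of_le_one_left (norm_nonneg _) h1).trans ?_
  refine (Complex.norm_Gamma_le_Gamma_re (by rw [h2]; linarith)).trans ?_
  refine (Real.Gamma_le_exp (by rw [h2]; linarith)).trans ?_
  rw [h2]
  gcongr
  linarith [Complex.re_le_norm s]

theorem DirichletCharacter.exists_norm_completedLFunction_le_exp {N : ℕ} [NeZero N] {χ : DirichletCharacter ℂ N}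
    (hχ : χ ≠ 1) :
    ∃ K : ℝ, 0 < K ∧ ∀ s : ℂ, 0 ≤ s.re →
      ‖completedLFunction χ s‖ ≤ Real.exp (K * (1 + ‖s‖) ^ (3 / 2 : ℝ)) := by
  obtain ⟨B, hB⟩ := exists_norm_completedLFunction_le hχ 4
  obtain ⟨A, hA0, hA⟩ := exists_norm_LFunction_le
  refine ⟨|B| + A + 8, by positivity, fun s hs => ?_⟩
  have hone : 1 ≤ (1 + ‖s‖) ^ (3 / 2 : ℝ) := Real.one_le_rpow (by simp) (by norm_num)
  have key : ∀ D : ℝ, D ≤ Real.exp D := fun D => by linarith [Real.add_one_le_exp D]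
  rcases le_total s.re 4 with h4 | h4
  · refine ((hB s hs h4).trans (le_abs_self B)).trans ((key _).trans (Real.exp_le_exp.2 ?_))
    nlinarith [abs_nonneg B]
  · rw [completedLFunction_eq_gammaFactor_mul χ (by linarith), norm_mul]
    obtain ⟨a, ha, hg⟩ := gammaFactor_eq χ
    have ha0 : 0 ≤ a := by rcases ha with h | h <;> simp [h]
    have ha1 : a ≤ 1 := by rcases ha with h | h <;> simp [h]
    have h1 : ‖gammaFactor χ s‖ ≤ Real.exp (8 * (1 + ‖s‖) ^ (3 / 2 : ℝ)) := by
      rw [hg]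
      refine (Complex.norm_Gammaℝ_le (by simp; linarith)).trans (Real.exp_le_exp.2 ?_)
      have h2 : 1 + ‖s + a‖ ≤ 2 * (1 + ‖s‖) := by
        have := norm_add_le s (a : ℂ)
        rw [Complex.norm_real, Real.norm_of_nonneg ha0] at this
        linarith [norm_nonneg s]
      calc 2 * (1 + ‖s + a‖) ^ (3 / 2 : ℝ) ≤ 2 * (2 * (1 + ‖s‖)) ^ (3 / 2 : ℝ) := by gcongr
        _ = 2 * (2 : ℝ) ^ (3 / 2 : ℝ) * (1 + ‖s‖) ^ (3 / 2 : ℝ) := by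
          rw [Real.mul_rpow (by norm_num) (by positivity)]; ring
        _ ≤ 2 * (2 : ℝ) ^ (2 : ℝ) * (1 + ‖s‖) ^ (3 / 2 : ℝ) := by gcongr <;> norm_num
        _ = _ := by norm_num
    calc ‖gammaFactor χ s‖ * ‖LFunction χ s‖
        ≤ Real.exp (8 * (1 + ‖s‖) ^ (3 / 2 : ℝ)) * Real.exp A := by
          gcongr
          exact (hA N χ s (by linarith)).trans (key A)
      _ ≤ _ := by
          rw [← Real.exp_add]
          gcongr
          nlinarith [abs_nonneg B]

namespace DirichletCharacter

open ComplexConjugate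

/-- The completed L-function of `χ`, recentred at the point `1 / 2` and multiplied by a power of the
level so that its functional equation relates `-z` to `z` with a constant factor. -/
noncomputable def centeredLFunction {N : ℕ} [NeZero N] (χ : DirichletCharacter ℂ N) (z : ℂ) : ℂ :=
  (N : ℂ) ^ (z / 2) * completedLFunction χ (1 / 2 + z)

theorem IsPrimitive.ne_one {q : ℕ} {χ : DirichletCharacter ℂ q} (hχ : χ.IsPrimitive) (hq : 2 ≤ q) : χ ≠ 1 := by
  have : NeZero q := ⟨by omega⟩
  rintro rfl
  rw [isPrimitive_def, conductor_one] at hχ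
  omega

variable {N : ℕ} [NeZero N] {χ : DirichletCharacter ℂ N}

theorem analyticAt_natCast_cpow_half (z : ℂ) : AnalyticAt ℂ (fun z : ℂ => (N : ℂ) ^ (z / 2)) z := by
  have : Differentiable ℂ (fun z : ℂ => (N : ℂ) ^ (z / 2)) := fun z =>
    DifferentiableAt.const_cpow (by fun_prop) (Or.inl (NeZero.ne _))
  exact this.analyticAt z

theorem natCast_cpow_ne_zero (z : ℂ) : (N : ℂ) ^ z ≠ 0 := by
  simp [Complex.cpow_eq_zero_iff, NeZero.ne]

theorem differentiable_centeredLFunction (hχ : χ ≠ 1) : Differentiable ℂ (centeredLFunction χ) := fun z =>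
  (analyticAt_natCast_cpow_half z).differentiableAt.mul
    (((differentiable_completedLFunction hχ).comp (differentiable_id.const_add (1 / 2))) z)

theorem centeredLFunction_neg (hχ : χ.IsPrimitive) (z : ℂ) :
    centeredLFunction χ (-z) = rootNumber χ * centeredLFunction χ⁻¹ z := by
  have h : (N : ℂ) ^ z = (N : ℂ) ^ (z / 2) * (N : ℂ) ^ (z / 2) := by
    rw [← Complex.cpow_add _ _ (NeZero.ne _), add_halves]
  have h' : (N : ℂ) ^ (-z / 2) * (N : ℂ) ^ (z / 2) = 1 := by
    rw [← Complex.cpow_add _ _ (NeZero.ne _)]; simp [← add_div]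
  rw [centeredLFunction, centeredLFunction, show (1 / 2 : ℂ) + -z = 1 - (1 / 2 + z) by ring,
    hχ.completedLFunction_one_sub, add_sub_cancel_left, h]
  linear_combination ((N : ℂ) ^ (z / 2) * rootNumber χ * completedLFunction χ⁻¹ (1 / 2 + z)) * h'

theorem centeredLFunction_inv_conj (hχ : χ ≠ 1) (z : ℂ) :
    centeredLFunction χ⁻¹ (conj z) = conj (centeredLFunction χ z) := by
  have h1 : (1 / 2 : ℂ) + conj z = conj (1 / 2 + z) := by simp [Complex.conj_ofNat]
  have h2 : conj z / 2 = conj (z / 2) := by simp [Complex.conj_ofNat]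
  rw [centeredLFunction, centeredLFunction, h1, completedLFunction_inv_conj hχ, h2,
    Complex.cpow_conj _ _ (by rw [Complex.natCast_arg]; exact Real.pi_ne_zero.symm), map_mul, Complex.conj_natCast]

theorem centeredLFunction_eq_zero_iff {z : ℂ} (hz : -(1 / 2) < z.re) :
    centeredLFunction χ z = 0 ↔ LFunction χ (1 / 2 + z) = 0 := by
  have hs : 0 < (1 / 2 + z).re := by simp; linarith
  rw [centeredLFunction, completedLFunction_eq_gammaFactor_mul χ hs, mul_eq_zero,
    or_iff_right (natCast_cpow_ne_zero _), mul_eq_zero, or_iff_right (gammaFactor_ne_zero χ hs)]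

theorem centeredLFunction_ne_zero (hχ : χ ≠ 1) {z : ℂ} (hz : 1 / 2 ≤ z.re) : centeredLFunction χ z ≠ 0 := by
  rw [Ne, centeredLFunction_eq_zero_iff (by linarith)]
  exact LFunction_ne_zero_of_one_le_re χ (Or.inl hχ) (by simp; linarith)

theorem rootNumber_ne_zero (hχ : χ.IsPrimitive) (hχ1 : χ ≠ 1) : rootNumber χ ≠ 0 := fun h => by
  have := centeredLFunction_neg hχ (-1)
  rw [h, zero_mul, neg_neg] at this
  exact centeredLFunction_ne_zero hχ1 (by norm_num) this

theorem re_eq_zero_of_centeredLFunction_eq_zero (hχ : χ.IsPrimitive) (hχ1 : χ ≠ 1)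
    (hgrh : ∀ s : ℂ, 0 < s.re → s.re < 1 → LFunction χ s = 0 → s.re = 1 / 2) {z : ℂ}
    (hz : centeredLFunction χ z = 0) : z.re = 0 := by
  rcases le_or_gt (1 / 2) z.re with h1 | h1
  · exact absurd hz (centeredLFunction_ne_zero hχ1 h1)
  rcases le_or_gt z.re (-(1 / 2)) with h2 | h2
  · have h3 := centeredLFunction_neg hχ (-z)
    rw [neg_neg, hz] at h3
    exact absurd h3.symm (mul_ne_zero (rootNumber_ne_zero hχ hχ1)
      (centeredLFunction_ne_zero (inv_ne_one.2 hχ1) (by simp; linarith)))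
  · have h3 := hgrh (1 / 2 + z) (by simp; linarith) (by simp; linarith)
      ((centeredLFunction_eq_zero_iff h2).1 hz)
    simpa using h3

theorem re_logDeriv_centeredLFunction_neg (hχ : χ.IsPrimitive) (hχ1 : χ ≠ 1) (y : ℝ) :
    (logDeriv (centeredLFunction χ) (-y)).re = -(logDeriv (centeredLFunction χ) y).re := by
  have hf := differentiable_centeredLFunction hχ1
  have h1 : ∀ z, centeredLFunction χ (-z) = rootNumber χ * (conj ∘ centeredLFunction χ ∘ conj) z := fun z => by
    rw [centeredLFunction_neg hχ, ← Complex.conj_conj z, centeredLFunction_inv_conj hχ1]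
    simp
  have h2 : deriv (fun z => centeredLFunction χ (-z)) y = rootNumber χ * conj (deriv (centeredLFunction χ) y) := by
    rw [funext h1, deriv_const_mul _ (by simpa using (hf (conj (y : ℂ))).conj_conj), deriv_conj_conj,
      Function.comp_apply, Function.comp_apply, Complex.conj_ofReal]
  rw [deriv_comp_neg] at h2
  have h3 : logDeriv (centeredLFunction χ) (-y) = -conj (logDeriv (centeredLFunction χ) y) := by
    rw [logDeriv_apply, logDeriv_apply, map_div₀, h1, neg_eq_iff_eq_neg.1 h2, Function.comp_apply,
      Function.comp_apply, Complex.conj_ofReal, neg_div, mul_div_mul_left _ _ (rootNumber_ne_zero hχ hχ1)]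
  rw [h3]
  simp

theorem logDeriv_centeredLFunction (hχ : χ ≠ 1) {z : ℂ} (hz : 1 / 2 ≤ z.re) :
    logDeriv (centeredLFunction χ) z = Real.log N / 2 + logDeriv (completedLFunction χ) (1 / 2 + z) := by
  have h0 := centeredLFunction_ne_zero hχ hz
  have hd : HasDerivAt (fun z : ℂ => (N : ℂ) ^ (z / 2)) ((N : ℂ) ^ (z / 2) * Complex.log N * (1 / 2)) z :=
    HasDerivAt.const_cpow ((hasDerivAt_id z).div_const 2) (Or.inl (NeZero.ne _))
  have h1 := logDeriv_mul (f := fun z : ℂ => (N : ℂ) ^ (z / 2)) (g := fun z => completedLFunction χ (1 / 2 + z)) z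
    (natCast_cpow_ne_zero _) (right_ne_zero_of_mul h0) hd.differentiableAt
    (((differentiable_completedLFunction hχ).comp (differentiable_id.const_add (1 / 2))) z)
  have h2 : logDeriv (fun z : ℂ => (N : ℂ) ^ (z / 2)) z = Real.log N / 2 := by
    rw [logDeriv_apply, hd.deriv, Complex.natCast_log]
    field_simp [natCast_cpow_ne_zero (N := N) (z / 2)]
  have h3 : logDeriv (fun z => completedLFunction χ (1 / 2 + z)) z = logDeriv (completedLFunction χ) (1 / 2 + z) := by
    rw [logDeriv_apply, logDeriv_apply, deriv_comp_const_add]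
  rw [← h2, ← h3, ← h1]
  rfl

theorem exists_norm_centeredLFunction_le_exp_of_nonneg (hχ : χ ≠ 1) :
    ∃ K : ℝ, 0 < K ∧ ∀ z : ℂ, 0 ≤ z.re →
      ‖centeredLFunction χ z‖ ≤ Real.exp (K * (1 + ‖z‖) ^ (3 / 2 : ℝ)) := by
  obtain ⟨K, hK, h⟩ := exists_norm_completedLFunction_le_exp hχ
  have hN : (1 : ℝ) ≤ N := by exact_mod_cast NeZero.one_le
  have hlog := Real.log_nonneg hN
  refine ⟨Real.log N + 4 * K, by positivity, fun z hz => ?_⟩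
  have h1 : ‖(N : ℂ) ^ (z / 2)‖ ≤ Real.exp (Real.log N * (1 + ‖z‖) ^ (3 / 2 : ℝ)) := by
    rw [Complex.norm_natCast_cpow_of_pos (NeZero.pos N), Real.rpow_def_of_pos (by linarith)]
    refine Real.exp_le_exp.2 (mul_le_mul_of_nonneg_left ?_ hlog)
    have h2 : (z / 2).re ≤ 1 + ‖z‖ := by
      have := Complex.re_le_norm z
      simp
      linarith [norm_nonneg z]
    exact h2.trans (Real.self_le_rpow_of_one_le (by simp) (by norm_num))
  have h2 : ‖completedLFunction χ (1 / 2 + z)‖ ≤ Real.exp (4 * K * (1 + ‖z‖) ^ (3 / 2 : ℝ)) := by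
    refine (h _ (by simp; linarith)).trans (Real.exp_le_exp.2 ?_)
    have h3 : 1 + ‖1 / 2 + z‖ ≤ 2 * (1 + ‖z‖) := by
      have := norm_add_le (1 / 2 : ℂ) z
      norm_num at this ⊢
      linarith [norm_nonneg z]
    calc K * (1 + ‖1 / 2 + z‖) ^ (3 / 2 : ℝ) ≤ K * (2 * (1 + ‖z‖)) ^ (3 / 2 : ℝ) := by gcongr
      _ = K * (2 : ℝ) ^ (3 / 2 : ℝ) * (1 + ‖z‖) ^ (3 / 2 : ℝ) := by
        rw [Real.mul_rpow (by norm_num) (by positivity)]; ring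
      _ ≤ K * (2 : ℝ) ^ (2 : ℝ) * (1 + ‖z‖) ^ (3 / 2 : ℝ) := by gcongr <;> norm_num
      _ = _ := by rw [show (2 : ℝ) ^ (2 : ℝ) = 4 by norm_num]; ring
  rw [centeredLFunction, norm_mul, add_mul, Real.exp_add]
  gcongr

theorem exists_norm_centeredLFunction_le_exp (hχ : χ.IsPrimitive) (hχ1 : χ ≠ 1) :
    ∃ K : ℝ, 0 < K ∧ ∀ z : ℂ, ‖centeredLFunction χ z‖ ≤ Real.exp (K * (1 + ‖z‖) ^ (3 / 2 : ℝ)) := by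
  obtain ⟨K, hK, h⟩ := exists_norm_centeredLFunction_le_exp_of_nonneg hχ1
  obtain ⟨K', hK', h'⟩ := exists_norm_centeredLFunction_le_exp_of_nonneg (inv_ne_one.2 hχ1)
  refine ⟨K + K' + ‖rootNumber χ‖, by positivity, fun z => ?_⟩
  have hone : 1 ≤ (1 + ‖z‖) ^ (3 / 2 : ℝ) := Real.one_le_rpow (by simp) (by norm_num)
  rcases le_total 0 z.re with hz | hz
  · refine (h z hz).trans (Real.exp_le_exp.2 ?_)
    gcongr
    linarith [norm_nonneg (rootNumber χ)]
  · have h1 := h' (-z) (by simpa using hz)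
    rw [← neg_neg z, centeredLFunction_neg hχ, norm_mul, norm_neg (-z)]
    calc ‖rootNumber χ‖ * ‖centeredLFunction χ⁻¹ (-z)‖
        ≤ Real.exp ‖rootNumber χ‖ * Real.exp (K' * (1 + ‖-z‖) ^ (3 / 2 : ℝ)) := by
          gcongr
          linarith [Real.add_one_le_exp ‖rootNumber χ‖]
      _ ≤ _ := by
          rw [← Real.exp_add, norm_neg]
          gcongr
          nlinarith [norm_nonneg (rootNumber χ)]

theorem zeroMult_centeredLFunction (hχ : χ ≠ 1) {z : ℂ} (hz : -(1 / 2) < z.re) :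
    zeroMult (centeredLFunction χ) z = zeroMult (LFunction χ) (1 / 2 + z) := by
  have hs : 0 < (1 / 2 + z).re := by simp; linarith
  have hΛ := differentiable_completedLFunction hχ
  have hL : AnalyticAt ℂ (LFunction χ) (1 / 2 + z) := (differentiable_LFunction hχ).analyticAt _
  have hg : AnalyticAt ℂ (gammaFactor χ) (1 / 2 + z) := by
    rw [Complex.analyticAt_iff_eventually_differentiableAt]
    filter_upwards [(isOpen_lt continuous_const Complex.continuous_re).mem_nhds hs] with w hw
    exact differentiableAt_gammaFactor χ hw
  calc zeroMult (centeredLFunction χ) z = zeroMult (fun w => completedLFunction χ (1 / 2 + w)) z :=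
        zeroMult_mul_left (analyticAt_natCast_cpow_half z)
          ((hΛ.comp (differentiable_id.const_add (1 / 2))).analyticAt z) (natCast_cpow_ne_zero _)
    _ = zeroMult (completedLFunction χ) (1 / 2 + z) := zeroMult_comp_add_left _ _
    _ = zeroMult (gammaFactor χ * LFunction χ) (1 / 2 + z) := by
        rw [zeroMult_eq_analyticOrderNatAt (hΛ.analyticAt _), zeroMult_eq_analyticOrderNatAt (hg.mul hL),
          analyticOrderNatAt, analyticOrderNatAt,
          analyticOrderAt_congr (completedLFunction_eventuallyEq χ hs)]
    _ = zeroMult (LFunction χ) (1 / 2 + z) := zeroMult_mul_left hg hL (gammaFactor_ne_zero χ hs)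

end DirichletCharacter

theorem LFun_eq_LFunction {q : ℕ} [NeZero q] (χ : DirichletCharacter ℂ q) :
    LFun q χ = DirichletCharacter.LFunction χ :=
  funext fun _ => dif_pos (NeZero.ne q)

theorem sum_over_low_zeros_asymptotic :
    ∃ C : ℝ, 0 < C ∧ ∀ (q : ℕ) (χ : DirichletCharacter ℂ q), 3 ≤ q → χ.IsPrimitive →
      (∀ s : ℂ, 0 < s.re → s.re < 1 → LFun q χ s = 0 → s.re = 1 / 2) →
      ∀ T : ℝ, 1 ≤ T →
        |(∑' γ : ℝ, Set.indicator {γ : ℝ | |γ| < T}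
            (fun γ => (zeroMult (LFun q χ) (1 / 2 + γ * Complex.I) : ℝ) /
              Real.sqrt (1 / 4 + γ ^ 2)) γ) -
          (1 / Real.pi) * Real.log ((q : ℝ) * Real.sqrt T) * Real.log T| ≤
          C * Real.log ((q : ℝ) * T) := by
  obtain ⟨A, hA0, hA⟩ := DirichletCharacter.exists_abs_re_logDeriv_completedLFunction_sub_le
  refine ⟨30 * (1 + (1 + A)), by positivity, fun q χ hq hχ hgrh T hT => ?_⟩
  have : NeZero q := ⟨by omega⟩
  have hχ1 : χ ≠ 1 := hχ.ne_one (by omega)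
  rw [LFun_eq_LFunction] at hgrh ⊢
  set f := DirichletCharacter.centeredLFunction χ with hf
  have hfd : Differentiable ℂ f := DirichletCharacter.differentiable_centeredLFunction hχ1
  obtain ⟨K, hK, hgrowth⟩ := DirichletCharacter.exists_norm_centeredLFunction_le_exp hχ hχ1
  obtain ⟨Z, hZ, hsum⟩ := exists_finset_zeros_sum_near_logDeriv hfd hK hgrowth
    (fun z hz => DirichletCharacter.re_eq_zero_of_centeredLFunction_eq_zero hχ hχ1 hgrh hz)
    (fun y _ => DirichletCharacter.re_logDeriv_centeredLFunction_neg hχ hχ1 y) (by linarith : 0 < 2 * T)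
  have hmult : ∀ γ : ℝ, zeroMult (DirichletCharacter.LFunction χ) (1 / 2 + γ * Complex.I) =
      zeroMult f (γ * Complex.I) := fun γ =>
    (DirichletCharacter.zeroMult_centeredLFunction hχ1 (by norm_num)).symm
  have hq0 : (0 : ℝ) < q := by exact_mod_cast NeZero.pos q
  have hlow := abs_sum_low_sub_le (by positivity : 0 ≤ 1 + A) (by exact_mod_cast hq : (3 : ℝ) ≤ q) hT Z
    (fun γ => zeroMult f (γ * Complex.I)) (fun γ => Nat.cast_nonneg _) (fun y hy hyT => by
      have h1 := hsum y (by linarith) hyT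
      have h2 := hA q χ y hy
      have h3 : (logDeriv f y).re =
          Real.log q / 2 + (logDeriv (DirichletCharacter.completedLFunction χ) (1 / 2 + y)).re := by
        rw [hf, DirichletCharacter.logDeriv_centeredLFunction hχ1 (by simp; linarith), Complex.add_re]
        congr 1
        rw [← Complex.ofReal_ofNat, ← Complex.ofReal_div, Complex.ofReal_re]
      rw [Real.log_mul hq0.ne' (by linarith)]
      rw [abs_le] at h1 h2 ⊢
      constructor <;> linarith [h1.1, h1.2, h2.1, h2.2])
  rw [tsum_eq_sum (s := Z) fun γ hγ => ?_]
  · simpa only [Set.indicator_apply, Set.mem_ofPred_eq, hmult] using hlow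
  · refine Set.indicator_apply_eq_zero.2 fun (hγT : |γ| < T) => ?_
    have h0 : f (γ * Complex.I) ≠ 0 := fun h => hγ (hZ γ (by linarith) h)
    have hf0 := hfd.analyticAt (γ * Complex.I)
    rw [hmult, zeroMult_eq_analyticOrderNatAt hf0, analyticOrderNatAt, hf0.analyticOrderAt_eq_zero.2 h0]
    simp
end

section
/- Let q ≥ 3 and let L be a real number with 1 ≤ L ≤ φ(q). Then the number of Dirichlet characters χ mod q whose conductor q* satisfies q* ≤ L is at most min{L·τ(q), L²}, where τ(q) is the number of divisors of q and φ is Euler's totient. -/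
open Filter Topology MeasureTheory

open scoped Classical
open Asymptotics

/-- The number of characters mod `q` whose conductor satisfies `P` is at most the sum of `φ(d)`
over the divisors `d` of `q` satisfying `P`. -/
theorem card_conductor_le_sum_totient (q : ℕ) [NeZero q] (P : ℕ → Prop) :
    Nat.card {χ : DirichletCharacter ℂ q | P χ.conductor} ≤
      ∑ d ∈ q.divisors.filter P, d.totient := by
  have hsub : {χ : DirichletCharacter ℂ q | P χ.conductor} ⊆
      ⋃ d ∈ q.divisors.filter P, {χ : DirichletCharacter ℂ q | χ.FactorsThrough d} := by
    intro χ hχ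
    simp only [Set.mem_iUnion]
    exact ⟨χ.conductor, Finset.mem_filter.2
      ⟨Nat.mem_divisors.2 ⟨χ.conductor_dvd_level, NeZero.ne q⟩, hχ⟩, χ.factorsThrough_conductor⟩
  rw [Nat.card_coe_set_eq]
  refine (Set.ncard_le_ncard hsub (Set.toFinite _)).trans
    ((Finset.set_ncard_biUnion_le _ _).trans (Finset.sum_le_sum fun d hd => ?_))
  have hdq : d ∣ q := Nat.dvd_of_mem_divisors (Finset.mem_filter.1 hd).1
  have : NeZero d := ⟨ne_zero_of_dvd_ne_zero (NeZero.ne q) hdq⟩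
  have himage : {χ : DirichletCharacter ℂ q | χ.FactorsThrough d} =
      DirichletCharacter.changeLevel hdq '' (Set.univ : Set (DirichletCharacter ℂ d)) := by
    ext χ
    constructor
    · intro h
      exact ⟨h.χ₀, Set.mem_univ _, h.eq_changeLevel.symm⟩
    · rintro ⟨ψ, -, rfl⟩
      exact ψ.changeLevel_factorsThrough hdq
  rw [himage, Set.ncard_image_of_injective _ (DirichletCharacter.changeLevel_injective hdq),
    Set.ncard_univ, DirichletCharacter.card_eq_totient_of_hasEnoughRootsOfUnity]

theorem count_characters_with_small_conductor (q : ℕ) (hq : 3 ≤ q) (L : ℝ)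
    (hL1 : 1 ≤ L) (hL2 : L ≤ (q.totient : ℝ)) :
    (Nat.card {χ : DirichletCharacter ℂ q |
        (DirichletCharacter.conductor χ : ℝ) ≤ L} : ℝ) ≤
      min (L * (q.divisors.card : ℝ)) (L ^ 2) := by
  have : NeZero q := ⟨by omega⟩
  have hL0 : 0 ≤ L := zero_le_one.trans hL1
  set D := q.divisors.filter fun d : ℕ => (d : ℝ) ≤ L with hD
  have hcard : (Nat.card {χ : DirichletCharacter ℂ q |
      (DirichletCharacter.conductor χ : ℝ) ≤ L} : ℝ) ≤ L * D.card := by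
    calc
      _ ≤ ((∑ d ∈ D, d.totient : ℕ) : ℝ) := by
        exact_mod_cast card_conductor_le_sum_totient q fun d : ℕ => (d : ℝ) ≤ L
      _ = ∑ d ∈ D, (d.totient : ℝ) := Nat.cast_sum _ _
      _ ≤ ∑ _d ∈ D, L := Finset.sum_le_sum fun d hd =>
        (Nat.cast_le.2 (Nat.totient_le d)).trans (Finset.mem_filter.1 hd).2
      _ = L * D.card := by rw [Finset.sum_const, nsmul_eq_mul, mul_comm]
  refine le_min (hcard.trans ?_) (hcard.trans ?_)
  · gcongr
    exact Finset.filter_subset _ _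
  · have hsub : D ⊆ Finset.Icc 1 ⌊L⌋₊ := fun d hd =>
      Finset.mem_Icc.2 ⟨Nat.pos_of_mem_divisors (Finset.mem_filter.1 hd).1,
        Nat.le_floor (Finset.mem_filter.1 hd).2⟩
    have hle : (D.card : ℝ) ≤ L :=
      calc
        (D.card : ℝ) ≤ (⌊L⌋₊ : ℝ) := by
          exact_mod_cast (Finset.card_le_card hsub).trans_eq (Nat.card_Icc 1 ⌊L⌋₊)
        _ ≤ L := Nat.floor_le hL0
    rw [sq]
    gcongr
end
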